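/- arXiv:1812.08078 — 2 statements merged into one kernel-verified Lean document; each statement's English description precedes it below -/
import Mathlib

section
/- (i) If σ_n²(1 + √(p_n/n)) = o(Δ_n²) as n → ∞, then almost full recovery is possible for (Ω_{Δ_n}), i.e., there exists a sequence of measurable estimators η̂_n with sup_{(θ,η)∈Ω_{Δ_n}} (1/n) E_{(θ,η)}[r(η̂_n(Y),η)] → 0. (ii) If Δ_n² = O(σ_n²(1 + √(p_n/n))) as n → ∞, then almost full recovery is impossible, i.e., liminf_{n→∞} inf_{η̃} sup_{(θ,η)∈Ω_{Δ_n}} (1/n) E_{(θ,η)}[r(η̃(Y),η)] > 0. -/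
open MeasureTheory ProbabilityTheory Filter Finset Asymptotics
open scoped ENNReal

noncomputable section

/-- Euclidean norm on `Fin p → ℝ`. -/
def eucNorm {p : ℕ} (θ : Fin p → ℝ) : ℝ := Real.sqrt (∑ i, θ i ^ 2)

/-- The set of label vectors in `{-1,1}^n`. -/
def pmOne (n : ℕ) : Set (Fin n → ℝ) := {η | ∀ i, η i = 1 ∨ η i = -1}

/-- `sgn s = 1` if `s ≥ 0` and `-1` otherwise. -/
def sgn (s : ℝ) : ℝ := if 0 ≤ s then 1 else -1

/-- Hamming-type loss `r(a,b) = min over ν ∈ {±1} of Σ_j |a_j - ν b_j|`. -/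
def lossR {n : ℕ} (a b : Fin n → ℝ) : ℝ :=
  min (∑ j, |a j - b j|) (∑ j, |a j + b j|)

/-- Law of `Y = θ ηᵀ + W`, where `W` has i.i.d. `N(0,σ²)` entries. -/
def lawY (p n : ℕ) (σ : ℝ) (θ : Fin p → ℝ) (η : Fin n → ℝ) :
    Measure (Fin p → Fin n → ℝ) :=
  Measure.pi fun i => Measure.pi fun j => gaussianReal (θ i * η j) (σ ^ 2).toNNReal

/-- Parameter set `Ω_Δ = {θ : ‖θ‖ ≥ Δ} × {-1,1}^n`. -/
def Omega (p n : ℕ) (Δ : ℝ) : Set ((Fin p → ℝ) × (Fin n → ℝ)) :=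
  {x | Δ ≤ eucNorm x.1 ∧ x.2 ∈ pmOne n}

/-- Expected loss of an estimator `f` at `(θ, η)`. -/
def risk (p n : ℕ) (σ : ℝ) (f : (Fin p → Fin n → ℝ) → Fin n → ℝ)
    (θ : Fin p → ℝ) (η : Fin n → ℝ) : ℝ :=
  ∫ y, lossR (f y) η ∂(lawY p n σ θ η)

/-- Minimax risk `Ψ_Δ`. -/
def minimaxRisk (p n : ℕ) (σ Δ : ℝ) : ℝ :=
  ⨅ f : {f : (Fin p → Fin n → ℝ) → Fin n → ℝ // Measurable f ∧ ∀ y, f y ∈ pmOne n},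
    ⨆ x : Omega p n Δ, (n : ℝ)⁻¹ * risk p n σ f.1 x.1.1 x.1.2

/-- Standard Gaussian upper tail `Φᶜ(t) = P(Z > t)`. -/
def Phic (t : ℝ) : ℝ := ((gaussianReal 0 1) {x | t < x}).toReal

/-- Signal-to-noise ratio `r_n = (Δ²/σ²)/√(Δ²/σ² + p/n)`. -/
def snr (p n : ℕ) (σ Δ : ℝ) : ℝ :=
  (Δ ^ 2 / σ ^ 2) / Real.sqrt (Δ ^ 2 / σ ^ 2 + (p : ℝ) / n)

/-- Gaussian product measure on `Fin p → ℝ` with i.i.d. centered coordinates of variance `v`. -/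
def gaussVec (p : ℕ) (v : ℝ) : Measure (Fin p → ℝ) :=
  Measure.pi fun _ => gaussianReal 0 v.toNNReal

/-- `G_σ(t, θ) = P((θ + σξ₁)ᵀ(θ + (σ/(n-1)) Σ_{j=2}^n ξ_j) ≤ ‖θ‖² t)` for i.i.d.
standard Gaussian vectors `ξ₁, …, ξ_n` in `ℝ^p`. -/
def Gfun (p n : ℕ) (σ t : ℝ) (θ : Fin p → ℝ) : ℝ :=
  (((gaussVec p 1).prod (Measure.pi fun _ : Fin (n - 1) => gaussVec p 1))
    {ξ | ∑ i, (θ i + σ * ξ.1 i) * (θ i + σ / ((n : ℝ) - 1) * ∑ j, ξ.2 j i)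
        ≤ eucNorm θ ^ 2 * t}).toReal

/-- Hollowed Gram matrix `H(YᵀY)` of the observation `y`, as a function. -/
def hollowGram {p n : ℕ} (y : Fin p → Fin n → ℝ) : Fin n → Fin n → ℝ :=
  fun a b => if a = b then 0 else ∑ i, y i a * y i b

/-- `v` is a unit-norm eigenvector of the matrix `M` for its largest eigenvalue. -/
def IsTopEigenvector {n : ℕ} (M : Fin n → Fin n → ℝ) (v : Fin n → ℝ) : Prop :=
  eucNorm v = 1 ∧ ∃ μ : ℝ, (∀ a, ∑ b, M a b * v b = μ * v a) ∧
    ∀ μ' : ℝ, (∃ w : Fin n → ℝ, w ≠ 0 ∧ ∀ a, ∑ b, M a b * w b = μ' * w a) → μ' ≤ μ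

/-- A spectral estimator: the entrywise sign of a measurable selection of a unit-norm
top eigenvector of `H(YᵀY)`. -/
def IsSpectralEstimator (p n : ℕ) (f : (Fin p → Fin n → ℝ) → Fin n → ℝ) : Prop :=
  Measurable f ∧ ∃ v : (Fin p → Fin n → ℝ) → Fin n → ℝ, Measurable v ∧
    (∀ y, IsTopEigenvector (hollowGram y) (v y)) ∧
    ∀ y a, f y a = sgn (v y a)

/-- Lloyd iterations `η̂^{k+1}(Y) = sign(H(YᵀY) η̂^k(Y))`, started from `f0`. -/
def lloydIter {p n : ℕ} (f0 : (Fin p → Fin n → ℝ) → Fin n → ℝ) :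
    ℕ → (Fin p → Fin n → ℝ) → Fin n → ℝ
  | 0 => f0
  | k + 1 => fun y a => sgn (∑ b, hollowGram y a b * lloydIter f0 k y b)

/-- Operator (spectral) norm of a real matrix with respect to Euclidean norms. -/
def opNorm {m n : ℕ} (M : Matrix (Fin m) (Fin n) ℝ) : ℝ :=
  ‖LinearMap.toContinuousLinearMap (Matrix.toEuclideanLin M)‖

/-- `H(M)`: the matrix `M` with its diagonal entries replaced by zero. -/
def hollow {n : ℕ} (M : Matrix (Fin n) (Fin n) ℝ) : Matrix (Fin n) (Fin n) ℝ :=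
  Matrix.of fun a b => if a = b then 0 else M a b

/-- Gram matrix `WᵀW` of a `p × n` array `w`. -/
def gramMat {p n : ℕ} (w : Fin p → Fin n → ℝ) : Matrix (Fin n) (Fin n) ℝ :=
  Matrix.of fun a b => ∑ i, w i a * w i b

/-- Law of a `p × n` random matrix with i.i.d. `N(0, τ²)` entries. -/
def lawW (p n : ℕ) (τ : ℝ) : Measure (Fin p → Fin n → ℝ) :=
  Measure.pi fun _ => Measure.pi fun _ => gaussianReal 0 (τ ^ 2).toNNReal

/-- Rademacher (uniform ±1) measure on `ℝ`. -/
def rademacher : Measure ℝ :=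
  (2 : ℝ≥0∞)⁻¹ • Measure.dirac (1 : ℝ) + (2 : ℝ≥0∞)⁻¹ • Measure.dirac (-1 : ℝ)

instance : IsProbabilityMeasure rademacher := by
  constructor
  simp [rademacher, Measure.add_apply, Measure.smul_apply, smul_eq_mul]
  rw [ENNReal.inv_two_add_inv_two]

/-- i.i.d. Rademacher vector measure on `Fin n → ℝ`. -/
def radVec (n : ℕ) : Measure (Fin n → ℝ) := Measure.pi fun _ => rademacher


open scoped NNReal


lemma aux_gauss_density (m : ℝ) {v : ℝ≥0} (hv : v ≠ 0) :
    gaussianReal m v = (gaussianReal 0 v).withDensity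
      (fun y => ENNReal.ofReal (Real.exp (m * y / v - m ^ 2 / (2 * v)))) := by
  rw [gaussianReal_of_var_ne_zero m hv, gaussianReal_of_var_ne_zero 0 hv,
    ← withDensity_mul _ (measurable_gaussianPDF 0 v) (by fun_prop)]
  congr 1
  ext y
  simp only [Pi.mul_apply, gaussianPDF, gaussianPDFReal]
  rw [← ENNReal.ofReal_mul (by positivity)]
  congr 1
  rw [mul_assoc (√_)⁻¹, ← Real.exp_add]
  congr 2
  have : (v : ℝ) ≠ 0 := by exact_mod_cast hv
  field_simp
  ring

lemma aux_pi_density {ι : Type*} [Fintype ι] {X : ι → Type*} [∀ i, MeasurableSpace (X i)]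
    (μ : (i : ι) → Measure (X i)) [∀ i, IsProbabilityMeasure (μ i)]
    (ν : (i : ι) → Measure (X i)) [∀ i, IsProbabilityMeasure (ν i)]
    (f : (i : ι) → X i → ℝ≥0∞) (hf : ∀ i, Measurable (f i))
    (h : ∀ i, ν i = (μ i).withDensity (f i)) :
    Measure.pi ν = (Measure.pi μ).withDensity (fun x => ∏ i, f i (x i)) := by
  classical
  refine Measure.pi_eq (fun s hs => ?_)
  rw [withDensity_apply _ (MeasurableSet.univ_pi hs), ← lintegral_indicator (MeasurableSet.univ_pi hs)]
  have : ∀ x : (i : ι) → X i, (Set.univ.pi s).indicator (fun x => ∏ i, f i (x i)) x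
      = ∏ i, (s i).indicator (f i) (x i) := by
    intro x
    by_cases hx : x ∈ Set.univ.pi s
    · rw [Set.indicator_of_mem hx]
      refine Finset.prod_congr rfl fun i _ => ?_
      rw [Set.indicator_of_mem (hx i (Set.mem_univ i))]
    · rw [Set.indicator_of_notMem hx]
      simp only [Set.mem_pi, Set.mem_univ, true_imp_iff, not_forall] at hx
      obtain ⟨i, hi⟩ := hx
      rw [Finset.prod_eq_zero (Finset.mem_univ i)]
      rw [Set.indicator_of_notMem hi]
  simp_rw [this]
  have hi := iIndepFun_pi (μ := μ) (X := fun i => (s i).indicator (f i))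
    (fun i => ((hf i).indicator (hs i)).aemeasurable)
  rw [lintegral_prod_eq_prod_lintegral_of_indepFun univ _ hi
    (fun i => ((hf i).indicator (hs i)).comp (measurable_pi_apply i))]
  refine Finset.prod_congr rfl fun i _ => ?_
  rw [h i, withDensity_apply _ (hs i), ← lintegral_indicator (hs i)]
  exact ((measurePreserving_eval μ i).lintegral_comp ((hf i).indicator (hs i)))

lemma aux_sum_law {Ω ι : Type*} [MeasurableSpace Ω] {P : Measure Ω} [IsProbabilityMeasure P]
    (X : ι → Ω → ℝ) (hm : ∀ i, Measurable (X i)) (v : ι → ℝ≥0)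
    (hX : ∀ i, P.map (X i) = gaussianReal 0 (v i)) (hi : iIndepFun X P) (s : Finset ι) :
    P.map (fun ω => ∑ i ∈ s, X i ω) = gaussianReal 0 (∑ i ∈ s, v i) := by
  classical
  induction s using Finset.induction_on with
  | empty => simp 
  | insert a s ha ih =>
    have h1 := (hi.indepFun_finsetSum_of_notMem hm ha).symm
    have e : (∑ j ∈ s, X j) = fun ω => ∑ i ∈ s, X i ω := by ext; simp
    rw [e] at h1
    have h2 := gaussianReal_add_gaussianReal_of_indepFun h1 (hX a) ih
    simp only [Finset.sum_insert ha]
    simpa [Pi.add_def] using h2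


lemma aux_sq_int (m : ℝ) (w : ℝ≥0) : Integrable (fun z : ℝ => z ^ 2) (gaussianReal m w) ∧
    ∫ z, z ^ 2 ∂(gaussianReal m w) = w + m ^ 2 := by
  have h := (memLp_id_gaussianReal (μ := m) (v := w) 2)
  refine ⟨by simpa using h.integrable_sq, ?_⟩
  have h2 := variance_eq_sub (μ := gaussianReal m w) (X := id) (by simpa using h)
  rw [variance_id_gaussianReal] at h2
  simp only [id_eq, Pi.pow_apply, integral_id_gaussianReal] at h2
  linarith

lemma aux_tilt (m : ℝ) {w : ℝ≥0} (hw : w ≠ 0) (F : ℝ → ℝ) :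
    (Integrable F (gaussianReal m w) →
      Integrable (fun z => Real.exp (m * z / w - m ^ 2 / (2 * w)) * F z) (gaussianReal 0 w)) ∧
    ∫ z, F z ∂(gaussianReal m w) =
      ∫ z, Real.exp (m * z / w - m ^ 2 / (2 * w)) * F z ∂(gaussianReal 0 w) := by
  rw [aux_gauss_density m hw]
  constructor
  · intro h
    rw [integrable_withDensity_iff_integrable_smul' (by fun_prop) (by simp)] at h
    simpa [ENNReal.toReal_ofReal, Real.exp_nonneg] using h
  · rw [integral_withDensity_eq_integral_toReal_smul (by fun_prop) (by simp)]
    simp [ENNReal.toReal_ofReal, Real.exp_nonneg]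

lemma aux_cosh {w : ℝ≥0} (hw : w ≠ 0) (F : ℝ → ℝ) (I : ℝ)
    (h1 : Integrable F (gaussianReal w w)) (h2 : Integrable F (gaussianReal (-w) w))
    (h3 : ∫ z, F z ∂(gaussianReal w w) = I) (h4 : ∫ z, F z ∂(gaussianReal (-w) w) = I) :
    Integrable (fun z => Real.cosh z * F z) (gaussianReal 0 w) ∧
    ∫ z, Real.cosh z * F z ∂(gaussianReal 0 w) = Real.exp (w / 2) * I := by
  have hw' : (w : ℝ) ≠ 0 := by exact_mod_cast hw
  obtain ⟨a1, b1⟩ := aux_tilt (w : ℝ) hw F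
  obtain ⟨a2, b2⟩ := aux_tilt (-w : ℝ) hw F
  have key : (fun z => Real.cosh z * F z) = fun z =>
      Real.exp (w / 2) / 2 * (Real.exp (w * z / w - w ^ 2 / (2 * w)) * F z
        + Real.exp (-w * z / w - (-w) ^ 2 / (2 * w)) * F z) := by
    ext z
    have e1 : (w * z / w - w ^ 2 / (2 * w) : ℝ) = z - w / 2 := by field_simp
    have e2 : (-w * z / w - (-w) ^ 2 / (2 * w) : ℝ) = -z - w / 2 := by field_simp
    rw [e1, e2, Real.exp_sub, Real.exp_sub, Real.cosh_eq]
    have := Real.exp_ne_zero ((w : ℝ) / 2)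
    field_simp
  rw [key]
  refine ⟨((a1 h1).add (a2 h2)).const_mul _, ?_⟩
  rw [integral_const_mul, integral_add (a1 h1) (a2 h2), ← b1, ← b2, h3, h4]
  ring

lemma aux_cosh_one {w : ℝ≥0} (hw : w ≠ 0) :
    Integrable (fun z => Real.cosh z) (gaussianReal 0 w) ∧
    ∫ z, Real.cosh z ∂(gaussianReal 0 w) = Real.exp (w / 2) := by
  have := aux_cosh hw (fun _ => 1) 1 (integrable_const _) (integrable_const _) (by simp) (by simp)
  simpa using this

lemma aux_cosh_sq {w : ℝ≥0} (hw : w ≠ 0) :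
    Integrable (fun z => Real.cosh z * z ^ 2) (gaussianReal 0 w) ∧
    ∫ z, Real.cosh z * z ^ 2 ∂(gaussianReal 0 w) = Real.exp (w / 2) * (w + w ^ 2) := by
  exact aux_cosh hw (fun z => z ^ 2) (w + w ^ 2) (aux_sq_int _ _).1 (aux_sq_int _ _).1
    (aux_sq_int _ _).2 (by simpa using (aux_sq_int (-w : ℝ) w).2)

lemma aux_num {l : ℝ} (h0 : 0 < l) (h1 : l ≤ 1 / 4) :
    (√(1 - 2 * l))⁻¹ ≤ Real.exp (l + 2 * l ^ 2) := by
  have hs : 0 < 1 - 2 * l := by linarith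
  have hq := Real.quadratic_le_exp_of_nonneg (x := 2 * l + 4 * l ^ 2) (by positivity)
  have h2 : 1 ≤ (1 - 2 * l) * Real.exp (2 * l + 4 * l ^ 2) := by
    refine le_trans ?_ (mul_le_mul_of_nonneg_left hq hs.le)
    have : 0 ≤ l ^ 2 * (1 - (2 * l) - (2 * l) ^ 2 - (2 * l) ^ 3) := by
      have : (2 * l) ^ 2 ≤ (1 / 2) ^ 2 := by gcongr; linarith
      have : (2 * l) ^ 3 ≤ (1 / 2) ^ 3 := by gcongr; linarith
      apply mul_nonneg (by positivity); nlinarith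
    nlinarith
  rw [inv_le_comm₀ (by positivity) (Real.exp_pos _), ← Real.exp_neg]
  apply Real.le_sqrt_of_sq_le
  rw [← Real.exp_nat_mul]
  have : ((2 : ℕ) : ℝ) * -(l + 2 * l ^ 2) = -(2 * l + 4 * l ^ 2) := by push_cast; ring
  rw [this, Real.exp_neg, inv_le_iff_one_le_mul₀ (Real.exp_pos _)]
  exact h2

lemma aux_chi {w : ℝ≥0} (hw : w ≠ 0) {l : ℝ} (h0 : 0 < l) (h1 : l ≤ 1 / 4) :
    Integrable (fun z : ℝ => Real.exp (l * (z ^ 2 / w - 1))) (gaussianReal 0 w) ∧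
    ∫ z, Real.exp (l * (z ^ 2 / w - 1)) ∂(gaussianReal 0 w) ≤ Real.exp (2 * l ^ 2) := by
  have hw' : (0 : ℝ) < w := by positivity
  set b : ℝ := (1 / 2 - l) / w with hb
  have hb0 : 0 < b := by apply div_pos _ hw'; linarith
  have key : ∀ z : ℝ, gaussianPDFReal 0 w z * Real.exp (l * (z ^ 2 / w - 1))
      = ((√(2 * Real.pi * w))⁻¹ * Real.exp (-l)) * Real.exp (-b * z ^ 2) := by
    intro z
    simp only [gaussianPDFReal]
    rw [mul_assoc (√_)⁻¹, mul_assoc (√_)⁻¹, ← Real.exp_add, ← Real.exp_add]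
    congr 2
    rw [hb]; field_simp; ring
  constructor
  · rw [gaussianReal_of_var_ne_zero 0 hw,
      integrable_withDensity_iff_integrable_smul' (measurable_gaussianPDF 0 w) (by simp [gaussianPDF_lt_top])]
    simp only [toReal_gaussianPDF, smul_eq_mul, key]
    exact (integrable_exp_neg_mul_sq hb0).const_mul _
  · rw [integral_gaussianReal_eq_integral_smul hw]
    simp only [smul_eq_mul, key]
    rw [integral_const_mul, integral_gaussian]
    have e : Real.pi / b = (2 * Real.pi * w) * (1 - 2 * l)⁻¹ := by
      rw [hb]
      have : 1 - 2 * l ≠ 0 := by linarith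
      have : 1 / 2 - l ≠ 0 := by linarith
      field_simp
    rw [e, Real.sqrt_mul (x := 2 * Real.pi * w) (by positivity) (1 - 2 * l)⁻¹, Real.sqrt_inv]
    have hq : √(2 * Real.pi * w) ≠ 0 := by positivity
    calc (√(2 * Real.pi * w))⁻¹ * Real.exp (-l) * (√(2 * Real.pi * w) * (√(1 - 2 * l))⁻¹)
        = Real.exp (-l) * (√(1 - 2 * l))⁻¹ := by field_simp
      _ ≤ Real.exp (-l) * Real.exp (l + 2 * l ^ 2) := by gcongr; exact aux_num h0 h1
      _ = _ := by rw [← Real.exp_add]; ring_nf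


lemma aux_lin_law (n : ℕ) (v : ℝ≥0) (a : Fin n → ℝ) (s : Finset (Fin n)) :
    (Measure.pi fun _ : Fin n => gaussianReal 0 v).map (fun y => ∑ k ∈ s, a k * y k)
      = gaussianReal 0 (∑ k ∈ s, NNReal.mk (a k ^ 2) (sq_nonneg _) * v) := by
  have hi := iIndepFun_pi (μ := fun _ : Fin n => gaussianReal 0 v) (X := fun k x => a k * x)
    (fun k => by fun_prop)
  refine aux_sum_law _ (fun k => by fun_prop) _ (fun k => ?_) hi s
  have := (measurePreserving_eval (fun _ : Fin n => gaussianReal 0 v) k).map_eq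
  have e : (fun ω : Fin n → ℝ => a k * ω k) = (fun x => a k * x) ∘ Function.eval k := rfl
  rw [e, ← Measure.map_map (by fun_prop) (by fun_prop), this, gaussianReal_map_const_mul]
  simp

instance (p n : ℕ) (σ : ℝ) : IsProbabilityMeasure (lawW p n σ) := by
  unfold lawW; infer_instance

instance (p n : ℕ) (σ : ℝ) (θ : Fin p → ℝ) (η : Fin n → ℝ) :
    IsProbabilityMeasure (lawY p n σ θ η) := by
  unfold lawY; infer_instance

lemma aux_lawY_map (p n : ℕ) (σ : ℝ) (θ : Fin p → ℝ) (η : Fin n → ℝ) :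
    lawY p n σ θ η = (lawW p n σ).map (fun w i j => θ i * η j + w i j) := by
  unfold lawY lawW
  have h1 : ∀ i, (Measure.pi fun j => gaussianReal (θ i * η j) (σ ^ 2).toNNReal)
      = (Measure.pi fun _ : Fin n => gaussianReal 0 (σ ^ 2).toNNReal).map
        (fun w j => θ i * η j + w j) := by
    intro i
    rw [Measure.pi_map_pi (f := fun j x => θ i * η j + x) (fun j => by fun_prop)]
    congr 1
    ext1 j
    rw [gaussianReal_map_const_add]
    simp
  simp_rw [h1]
  have hs : ∀ i, SigmaFinite ((Measure.pi fun _ : Fin n => gaussianReal 0 (σ ^ 2).toNNReal).map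
        (fun w j => θ i * η j + w j)) := by
    intro i; rw [← h1]; infer_instance
  exact (Measure.pi_map_pi
    (μ := fun _ : Fin p => Measure.pi fun _ : Fin n => gaussianReal 0 (σ ^ 2).toNNReal)
    (f := fun (i : Fin p) (w : Fin n → ℝ) (j : Fin n) => θ i * η j + w j)
    (fun i => Measurable.aemeasurable (by fun_prop))).symm

/-- column functional -/
lemma aux_col (p n : ℕ) {σ : ℝ} (θ : Fin p → ℝ) (j : Fin n) :
    Integrable (fun w => (∑ i, θ i * w i j) ^ 2) (lawW p n σ) ∧
    ∫ w, (∑ i, θ i * w i j) ^ 2 ∂(lawW p n σ) = σ ^ 2 * ∑ i, θ i ^ 2 := by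
  have hi := iIndepFun_pi (μ := fun _ : Fin p => Measure.pi fun _ : Fin n => gaussianReal 0 (σ ^ 2).toNNReal)
    (X := fun k (x : Fin n → ℝ) => θ k * x j) (fun k => Measurable.aemeasurable (by fun_prop))
  have hl := aux_sum_law (P := lawW p n σ) (fun k (w : Fin p → Fin n → ℝ) => θ k * w k j)
    (fun k => by fun_prop) (fun k => NNReal.mk (θ k ^ 2) (sq_nonneg _) * (σ ^ 2).toNNReal) (fun k => by
      have e : (fun ω : Fin p → Fin n → ℝ => θ k * ω k j)
        = (fun x => θ k * x) ∘ (Function.eval j) ∘ (Function.eval k) := rfl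
      rw [e, ← Measure.map_map (by fun_prop) (by fun_prop),
        ← Measure.map_map (by fun_prop) (by fun_prop)]
      unfold lawW
      rw [(measurePreserving_eval (fun _ : Fin p => Measure.pi fun _ : Fin n => gaussianReal 0 (σ ^ 2).toNNReal) k).map_eq,
        (measurePreserving_eval (fun _ : Fin n => gaussianReal 0 (σ ^ 2).toNNReal) j).map_eq,
        gaussianReal_map_const_mul]
      simp) hi univ
  have hm : Measurable (fun w : Fin p → Fin n → ℝ => ∑ i, θ i * w i j) := by fun_prop
  obtain ⟨h1, h2⟩ := aux_sq_int 0 (∑ k, NNReal.mk (θ k ^ 2) (sq_nonneg _) * (σ ^ 2).toNNReal)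
  rw [← hl] at h1 h2
  rw [integrable_map_measure (by fun_prop) hm.aemeasurable] at h1
  rw [integral_map hm.aemeasurable (by fun_prop)] at h2
  refine ⟨h1, ?_⟩
  rw [h2]
  push_cast
  rw [Real.coe_toNNReal _ (sq_nonneg σ), ← Finset.sum_mul]
  simp [mul_comm]

lemma aux_row_law (p n : ℕ) {σ : ℝ} (a : Fin n → ℝ) (ha : a ∈ pmOne n) (i : Fin p) :
    (lawW p n σ).map (fun w => ∑ j, w i j * a j) = gaussianReal 0 (n * (σ ^ 2).toNNReal) := by
  have e : (fun w : Fin p → Fin n → ℝ => ∑ j, w i j * a j)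
        = (fun y : Fin n → ℝ => ∑ j, a j * y j) ∘ (Function.eval i) := by
    ext w; simp [mul_comm]
  rw [e, ← Measure.map_map (by fun_prop) (by fun_prop)]
  unfold lawW
  rw [(measurePreserving_eval (fun _ : Fin p => Measure.pi fun _ : Fin n => gaussianReal 0 (σ ^ 2).toNNReal) i).map_eq,
    aux_lin_law]
  congr 1
  have : ∀ k, NNReal.mk (a k ^ 2) (sq_nonneg _) = 1 := by
    intro k; apply NNReal.eq; rcases ha k with h | h <;> simp [h]
  simp [this]

lemma aux_row (p n : ℕ) {σ : ℝ} (a : Fin n → ℝ) (ha : a ∈ pmOne n) (i : Fin p) :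
    Integrable (fun w => ∑ j, w i j * a j) (lawW p n σ) ∧
    ∫ w, ∑ j, w i j * a j ∂(lawW p n σ) = 0 ∧
    Integrable (fun w => (∑ j, w i j * a j) ^ 2) (lawW p n σ) ∧
    ∫ w, (∑ j, w i j * a j) ^ 2 ∂(lawW p n σ) = n * σ ^ 2 := by
  have hl := aux_row_law p n (σ := σ) a ha i
  have hm : Measurable (fun w : Fin p → Fin n → ℝ => ∑ j, w i j * a j) := by fun_prop
  obtain ⟨h1, h2⟩ := aux_sq_int 0 (n * (σ ^ 2).toNNReal)
  have h3 : Integrable (fun x : ℝ => x) (gaussianReal 0 (n * (σ ^ 2).toNNReal)) := by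
    have := (memLp_id_gaussianReal (μ := 0) (v := n * (σ ^ 2).toNNReal) 1)
    rw [← memLp_one_iff_integrable]; exact_mod_cast this
  have h4 := integral_id_gaussianReal (μ := 0) (v := n * (σ ^ 2).toNNReal)
  rw [← hl] at h1 h2 h3 h4
  rw [integrable_map_measure (by fun_prop) hm.aemeasurable] at h1 h3
  rw [integral_map hm.aemeasurable (by fun_prop)] at h2 h4
  refine ⟨h3, h4, h1, ?_⟩
  rw [h2]
  simp [Real.coe_toNNReal _ (sq_nonneg σ)]

lemma aux_expo (p n : ℕ) (hn : 0 < n) {σ : ℝ} (hσ : 0 < σ) (a : Fin n → ℝ) (ha : a ∈ pmOne n)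
    {l : ℝ} (h0 : 0 < l) (h1 : l ≤ 1 / 4) :
    Integrable (fun w => Real.exp (l * ((∑ i, (∑ j, w i j * a j) ^ 2) / (n * σ ^ 2) - p)))
      (lawW p n σ) ∧
    ∫ w, Real.exp (l * ((∑ i, (∑ j, w i j * a j) ^ 2) / (n * σ ^ 2) - p)) ∂(lawW p n σ)
      ≤ Real.exp (2 * l ^ 2 * p) := by
  have e : ∀ w : Fin p → Fin n → ℝ,
      Real.exp (l * ((∑ i, (∑ j, w i j * a j) ^ 2) / (n * σ ^ 2) - p))
      = ∏ i, Real.exp (l * ((∑ j, a j * w i j) ^ 2 / (n * σ ^ 2) - 1)) := by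
    intro w
    rw [← Real.exp_sum, ← Finset.mul_sum]
    simp [Finset.sum_div, mul_comm]
  simp_rw [e]
  have hl := aux_lin_law n (σ ^ 2).toNNReal a univ
  have hv : (∑ k, NNReal.mk (a k ^ 2) (sq_nonneg _) * (σ ^ 2).toNNReal) = n * (σ ^ 2).toNNReal := by
    have : ∀ k, NNReal.mk (a k ^ 2) (sq_nonneg _) = 1 := by
      intro k; apply NNReal.eq; rcases ha k with h | h <;> simp [h]
    simp [this]
  rw [hv] at hl
  have hw : (n * (σ ^ 2).toNNReal : ℝ≥0) ≠ 0 := by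
    have : 0 < (σ ^ 2).toNNReal := Real.toNNReal_pos.2 (by positivity)
    positivity
  obtain ⟨h2, h3⟩ := aux_chi hw h0 h1
  have hm : Measurable (fun y : Fin n → ℝ => ∑ j, a j * y j) := by fun_prop
  rw [← hl] at h2 h3
  rw [integrable_map_measure (by fun_prop) hm.aemeasurable] at h2
  rw [integral_map hm.aemeasurable (by fun_prop)] at h3
  simp only [NNReal.coe_mul, NNReal.coe_natCast, Real.coe_toNNReal _ (sq_nonneg σ)] at h2 h3
  set φ : (Fin n → ℝ) → ℝ := fun y => Real.exp (l * ((∑ j, a j * y j) ^ 2 / (n * σ ^ 2) - 1))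
    with hφ
  have hI : Integrable (fun w : Fin p → Fin n → ℝ => ∏ i, φ (w i)) (lawW p n σ) :=
    Integrable.fintype_prod (f := fun _ : Fin p => φ) (fun i => h2)
  have hE : ∫ w : Fin p → Fin n → ℝ, ∏ i, φ (w i) ∂(lawW p n σ)
      = (∫ y, φ y ∂(Measure.pi fun _ : Fin n => gaussianReal 0 (σ ^ 2).toNNReal)) ^ p := by
    unfold lawW
    rw [integral_fintype_prod_eq_pow φ, Fintype.card_fin]
  refine ⟨hI, ?_⟩
  rw [hE]
  calc _ ≤ (Real.exp (2 * l ^ 2)) ^ p := by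
        apply pow_le_pow_left₀ _ h3
        exact integral_nonneg (fun _ => (Real.exp_pos _).le)
    _ = _ := by rw [← Real.exp_nat_mul]; ring_nf

lemma aux_est (p n : ℕ) : ∃ f : (Fin p → Fin n → ℝ) → Fin n → ℝ, Measurable f ∧
    ∀ y, f y ∈ pmOne n ∧ ∀ a ∈ pmOne n,
      ∑ i, (∑ j, y i j * a j) ^ 2 ≤ ∑ i, (∑ j, y i j * f y j) ^ 2 := by
  classical
  have hfin : (pmOne n).Finite := by
    have : pmOne n = Set.univ.pi (fun _ => ({1, -1} : Set ℝ)) := by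
      ext; simp [pmOne]
    rw [this]
    exact Set.Finite.pi (fun _ => Set.toFinite _)
  have key : ∀ t : Finset (Fin n → ℝ), t.Nonempty →
      ∃ f : (Fin p → Fin n → ℝ) → Fin n → ℝ, Measurable f ∧
      ∀ y, f y ∈ t ∧ ∀ a ∈ t,
      ∑ i, (∑ j, y i j * a j) ^ 2 ≤ ∑ i, (∑ j, y i j * f y j) ^ 2 := by
    intro t ht
    induction ht using Finset.Nonempty.cons_induction with
    | singleton a => exact ⟨fun _ => a, measurable_const, fun y => by simp⟩
    | cons b t hb ht ih =>
      obtain ⟨f, hf, h⟩ := ih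
      refine ⟨fun y => if ∑ i, (∑ j, y i j * f y j) ^ 2 ≤ ∑ i, (∑ j, y i j * b j) ^ 2 then b else f y,
        Measurable.ite (measurableSet_le (by fun_prop) (by fun_prop)) measurable_const hf, ?_⟩
      intro y
      obtain ⟨h1, h2⟩ := h y
      dsimp only
      split_ifs with hc
      · refine ⟨by simp, fun a ha => ?_⟩
        rcases Finset.mem_cons.1 ha with rfl | ha
        · exact le_rfl
        · exact (h2 a ha).trans hc
      · refine ⟨by simp [h1], fun a ha => ?_⟩
        rcases Finset.mem_cons.1 ha with rfl | ha
        · exact (not_le.1 hc).le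
        · exact h2 a ha
  obtain ⟨f, hf, h⟩ := key hfin.toFinset ⟨fun _ => 1, by simp [pmOne]⟩
  exact ⟨f, hf, by simpa using h⟩


lemma aux_loss {n : ℕ} (a b : Fin n → ℝ) (ha : a ∈ pmOne n) (hb : b ∈ pmOne n) :
    lossR a b = n - |∑ j, a j * b j| := by
  have h1 : ∀ j, |a j - b j| = 1 - a j * b j := by
    intro j; rcases ha j with h | h <;> rcases hb j with h' | h' <;> norm_num [h, h']
  have h2 : ∀ j, |a j + b j| = 1 + a j * b j := by
    intro j; rcases ha j with h | h <;> rcases hb j with h' | h' <;> norm_num [h, h']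
  unfold lossR
  simp only [h1, h2, Finset.sum_sub_distrib, Finset.sum_add_distrib]
  simp only [sum_const, card_univ, Fintype.card_fin, nsmul_eq_mul, mul_one]
  rcases le_total 0 (∑ j, a j * b j) with h | h
  · rw [abs_of_nonneg h, min_eq_left (by linarith)]
  · rw [abs_of_nonpos h, min_eq_right (by linarith)]; ring

lemma aux_abs_le {n : ℕ} (a b : Fin n → ℝ) (ha : a ∈ pmOne n) (hb : b ∈ pmOne n) :
    |∑ j, a j * b j| ≤ n := by
  refine (Finset.abs_sum_le_sum_abs _ _).trans ?_
  have h1 : ∀ j, |a j * b j| = 1 := by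
    intro j; rcases ha j with h | h <;> rcases hb j with h' | h' <;> norm_num [h, h']
  simp [h1]

lemma aux_loss_bd {n : ℕ} (a b : Fin n → ℝ) (ha : a ∈ pmOne n) (hb : b ∈ pmOne n) :
    0 ≤ lossR a b ∧ lossR a b ≤ n := by
  rw [aux_loss a b ha hb]
  have := aux_abs_le a b ha hb
  have := abs_nonneg (∑ j, a j * b j)
  constructor <;> linarith

lemma aux_loss_meas {n : ℕ} (b : Fin n → ℝ) : Measurable (fun a : Fin n → ℝ => lossR a b) := by
  unfold lossR
  fun_prop

lemma aux_loss_int {p n : ℕ} {f : (Fin p → Fin n → ℝ) → Fin n → ℝ} (hf : Measurable f)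
    (hf2 : ∀ y, f y ∈ pmOne n) {η : Fin n → ℝ} (hη : η ∈ pmOne n)
    (μ : Measure (Fin p → Fin n → ℝ)) [IsFiniteMeasure μ] :
    Integrable (fun y => lossR (f y) η) μ := by
  refine Integrable.of_bound ((aux_loss_meas η).comp hf).aestronglyMeasurable (n : ℝ) ?_
  refine Filter.Eventually.of_forall fun y => ?_
  have := aux_loss_bd (f y) η (hf2 y) hη
  rw [Real.norm_eq_abs, abs_of_nonneg this.1]; exact this.2

lemma aux_risk_bd {p n : ℕ} {f : (Fin p → Fin n → ℝ) → Fin n → ℝ} (hf : Measurable f)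
    (hf2 : ∀ y, f y ∈ pmOne n) {η : Fin n → ℝ} (hη : η ∈ pmOne n) (σ : ℝ) (θ : Fin p → ℝ) :
    0 ≤ (n : ℝ)⁻¹ * risk p n σ f θ η ∧ (n : ℝ)⁻¹ * risk p n σ f θ η ≤ 1 := by
  have h0 : 0 ≤ risk p n σ f θ η := integral_nonneg fun y => (aux_loss_bd _ _ (hf2 y) hη).1
  have h1 : risk p n σ f θ η ≤ n := by
    unfold risk
    calc _ ≤ ∫ y, (n : ℝ) ∂(lawY p n σ θ η) :=
          integral_mono (aux_loss_int hf hf2 hη _) (integrable_const _)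
            fun y => (aux_loss_bd _ _ (hf2 y) hη).2
      _ = n := by simp
  refine ⟨by positivity, ?_⟩
  rcases Nat.eq_zero_or_pos n with rfl | hn
  · simp
  · rw [inv_mul_le_iff₀ (by positivity)]; linarith


/-- the sign vector of a Boolean vector -/
def sv {n : ℕ} (b : Fin n → Bool) : Fin n → ℝ := fun j => if b j then 1 else -1

lemma sv_mem {n : ℕ} (b : Fin n → Bool) : sv b ∈ pmOne n := by
  intro j; unfold sv; split_ifs <;> simp

lemma sv_surj {n : ℕ} {a : Fin n → ℝ} (ha : a ∈ pmOne n) : ∃ b, sv b = a := by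
  classical
  refine ⟨fun j => decide (a j = 1), ?_⟩
  ext j
  rcases ha j with h | h <;> norm_num [sv, h]

lemma aux_det {p n : ℕ} (hn : 0 < n) {θ : Fin p → ℝ} {η a : Fin n → ℝ} (hη : η ∈ pmOne n)
    (ha : a ∈ pmOne n) (w : Fin p → Fin n → ℝ)
    (hmax : ∑ i, (∑ j, (θ i * η j + w i j) * η j) ^ 2 ≤ ∑ i, (∑ j, (θ i * η j + w i j) * a j) ^ 2) :
    (∑ i, θ i ^ 2) * (n * lossR a η) ≤ 2 * n * ∑ j, |∑ i, θ i * w i j|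
      + ∑ i, (∑ j, w i j * a j) ^ 2 - 2 * n * (∑ i, θ i * ∑ j, w i j * η j)
      - ∑ i, (∑ j, w i j * η j) ^ 2 := by
  set m := ∑ j, a j * η j with hm
  have hmn : |m| ≤ n := aux_abs_le a η ha hη
  have hself : ∑ j, η j * η j = n := by
    have : ∀ j, η j * η j = 1 := by intro j; rcases hη j with h | h <;> norm_num [h]
    simp [this]
  have ex : ∀ c : Fin n → ℝ, ∑ i, (∑ j, (θ i * η j + w i j) * c j) ^ 2
      = (∑ i, θ i ^ 2) * (∑ j, c j * η j) ^ 2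
        + 2 * (∑ j, c j * η j) * (∑ i, θ i * ∑ j, w i j * c j)
        + ∑ i, (∑ j, w i j * c j) ^ 2 := by
    intro c
    have : ∀ i, ∑ j, (θ i * η j + w i j) * c j = θ i * (∑ j, c j * η j) + ∑ j, w i j * c j := by
      intro i
      rw [Finset.mul_sum, ← Finset.sum_add_distrib]
      refine Finset.sum_congr rfl fun j _ => by ring
    simp_rw [this, Finset.sum_mul, Finset.mul_sum (s := (univ : Finset (Fin p))), ← Finset.sum_add_distrib]
    refine Finset.sum_congr rfl fun i _ => by ring
  rw [ex, ex, hself, ← hm] at hmax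
  have hc : m * (∑ i, θ i * ∑ j, w i j * a j) ≤ n * ∑ j, |∑ i, θ i * w i j| := by
    have e : ∑ i, θ i * ∑ j, w i j * a j = ∑ j, a j * ∑ i, θ i * w i j := by
      simp_rw [Finset.mul_sum]
      rw [Finset.sum_comm]
      refine Finset.sum_congr rfl fun j _ => Finset.sum_congr rfl fun i _ => by ring
    have : |∑ i, θ i * ∑ j, w i j * a j| ≤ ∑ j, |∑ i, θ i * w i j| := by
      rw [e]
      refine (Finset.abs_sum_le_sum_abs _ _).trans (Finset.sum_le_sum fun j _ => ?_)
      rw [abs_mul]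
      rcases ha j with h | h <;> simp [h]
    refine (le_abs_self _).trans ?_
    rw [abs_mul]
    gcongr
  have hl : (n : ℝ) * lossR a η ≤ n ^ 2 - m ^ 2 := by
    rw [aux_loss a η ha hη, ← hm, ← sq_abs m]
    nlinarith [abs_nonneg m]
  have hN : 0 ≤ ∑ i, θ i ^ 2 := Finset.sum_nonneg fun i _ => sq_nonneg _
  have := mul_le_mul_of_nonneg_left hl hN
  nlinarith

lemma aux_upper {p n : ℕ} (hn : 0 < n) {σ : ℝ} (hσ : 0 < σ) {θ : Fin p → ℝ} {η : Fin n → ℝ}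
    (hη : η ∈ pmOne n) (hN : 0 < ∑ i, θ i ^ 2)
    {f : (Fin p → Fin n → ℝ) → Fin n → ℝ} (hf : Measurable f) (hf2 : ∀ y, f y ∈ pmOne n)
    (hf3 : ∀ y, ∀ a ∈ pmOne n, ∑ i, (∑ j, y i j * a j) ^ 2 ≤ ∑ i, (∑ j, y i j * f y j) ^ 2)
    {l : ℝ} (h0 : 0 < l) (h1 : l ≤ 1 / 4) :
    (∑ i, θ i ^ 2) * (n * risk p n σ f θ η) ≤ 2 * n ^ 2 * (σ * √(∑ i, θ i ^ 2))
      + n * σ ^ 2 * (n * Real.log 2 + 2 * l ^ 2 * p) / l := by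
  set N := ∑ i, θ i ^ 2 with hNdef
  set s := σ * √N with hs
  have hs0 : 0 < s := by positivity
  have hn' : (0 : ℝ) < n := by exact_mod_cast hn
  set c := n * Real.log 2 + 2 * l ^ 2 * p with hc
  have hmeas : Measurable (fun (w : Fin p → Fin n → ℝ) (i : Fin p) (j : Fin n) => θ i * η j + w i j) := by
    fun_prop
  set q : (Fin p → Fin n → ℝ) → (Fin n → ℝ) → ℝ := fun w a => ∑ i, (∑ j, w i j * a j) ^ 2 with hq
  set T1 : (Fin p → Fin n → ℝ) → ℝ := fun w => ∑ j, n * ((∑ i, θ i * w i j) ^ 2 / s + s) with hT1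
  set T2 : (Fin p → Fin n → ℝ) → ℝ := fun w =>
    ∑ b : Fin n → Bool, Real.exp (-c) * Real.exp (l * (q w (sv b) / (n * σ ^ 2) - p)) with hT2
  set T3 : (Fin p → Fin n → ℝ) → ℝ := fun w => ∑ i, θ i * ∑ j, w i j * η j with hT3
  have hpt : ∀ w, N * (n * lossR (f (fun i j => θ i * η j + w i j)) η)
      ≤ T1 w + n * σ ^ 2 * (p + l⁻¹ * (T2 w + (c - 1))) - 2 * n * T3 w - q w η := by
    intro w
    set a := f (fun i j => θ i * η j + w i j) with ha
    have hapm : a ∈ pmOne n := hf2 _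
    have hd := aux_det hn hη hapm w (hf3 (fun i j => θ i * η j + w i j) η hη)
    have hA : 2 * n * ∑ j, |∑ i, θ i * w i j| ≤ T1 w := by
      rw [hT1, Finset.mul_sum]
      refine Finset.sum_le_sum fun j _ => ?_
      have : 2 * |∑ i, θ i * w i j| ≤ (∑ i, θ i * w i j) ^ 2 / s + s := by
        rw [← sq_abs (∑ i, θ i * w i j)]
        set x := |∑ i, θ i * w i j|
        have e : x ^ 2 / s + s - 2 * x = (x - s) ^ 2 / s := by field_simp; ring
        have : 0 ≤ (x - s) ^ 2 / s := by positivity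
        linarith
      nlinarith
    have hB : q w a ≤ n * σ ^ 2 * (p + l⁻¹ * (T2 w + (c - 1))) := by
      obtain ⟨b, hb⟩ := sv_surj hapm
      have h2 : Real.exp (-c) * Real.exp (l * (q w a / (n * σ ^ 2) - p)) ≤ T2 w := by
        rw [← hb, hT2]
        exact Finset.single_le_sum (f := fun b : Fin n → Bool =>
          Real.exp (-c) * Real.exp (l * (q w (sv b) / (n * σ ^ 2) - p)))
          (fun i _ => by positivity) (Finset.mem_univ b)
      rw [← Real.exp_add] at h2
      have h3 := Real.add_one_le_exp (-c + l * (q w a / (n * σ ^ 2) - p))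
      have h4 : l * (q w a / (n * σ ^ 2) - p) ≤ T2 w + (c - 1) := by linarith
      have h5 : q w a / (n * σ ^ 2) ≤ p + l⁻¹ * (T2 w + (c - 1)) := by
        have : q w a / (n * σ ^ 2) - p ≤ l⁻¹ * (T2 w + (c - 1)) := by
          rw [le_inv_mul_iff₀ h0]; exact h4
        linarith
      rw [div_le_iff₀ (by positivity)] at h5
      linarith
    simp only [hq, hT3] at hB ⊢
    linarith
  have iT1 : Integrable T1 (lawW p n σ) ∧ ∫ w, T1 w ∂(lawW p n σ) = 2 * n ^ 2 * s := by
    have hI : ∀ j : Fin n, Integrable (fun w => n * ((∑ i, θ i * w i j) ^ 2 / s + s)) (lawW p n σ) :=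
      fun j => (((aux_col p n θ j).1.div_const s).add (integrable_const s)).const_mul _
    refine ⟨integrable_finsetSum _ fun j _ => hI j, ?_⟩
    rw [hT1, integral_finsetSum _ fun j _ => hI j]
    have : ∀ j : Fin n, ∫ w, n * ((∑ i, θ i * w i j) ^ 2 / s + s) ∂(lawW p n σ) = n * (2 * s) := by
      intro j
      rw [integral_const_mul, integral_add ((aux_col p n θ j).1.div_const s) (integrable_const s),
        integral_div, (aux_col p n θ j).2]
      have : σ ^ 2 * ∑ i, θ i ^ 2 = s ^ 2 := by
        rw [hs, mul_pow, Real.sq_sqrt hN.le]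
      rw [this]
      simp
      left
      field_simp
      ring
    simp_rw [this]
    simp
    ring
  have iT2 : Integrable T2 (lawW p n σ) ∧ ∫ w, T2 w ∂(lawW p n σ) ≤ 1 := by
    have hI : ∀ b : Fin n → Bool, Integrable (fun w => Real.exp (-c) *
        Real.exp (l * (q w (sv b) / (n * σ ^ 2) - p))) (lawW p n σ) :=
      fun b => (aux_expo p n hn hσ (sv b) (sv_mem b) h0 h1).1.const_mul _
    refine ⟨integrable_finsetSum _ fun j _ => hI j, ?_⟩
    rw [hT2, integral_finsetSum _ fun j _ => hI j]
    calc _ ≤ ∑ b : Fin n → Bool, Real.exp (-c) * Real.exp (2 * l ^ 2 * p) := by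
          refine Finset.sum_le_sum fun b _ => ?_
          rw [integral_const_mul]
          gcongr
          exact (aux_expo p n hn hσ (sv b) (sv_mem b) h0 h1).2
      _ = 1 := by
          have e2 : (2 : ℝ) ^ n = Real.exp (n * Real.log 2) := by
            rw [Real.exp_nat_mul, Real.exp_log (by norm_num)]
          simp only [sum_const, card_univ, Fintype.card_pi, Fintype.card_bool, prod_const,
            Fintype.card_fin, nsmul_eq_mul]
          push_cast
          rw [e2, ← Real.exp_add, ← Real.exp_add, hc, Real.exp_eq_one_iff]
          ring
  have iT3 : Integrable T3 (lawW p n σ) ∧ ∫ w, T3 w ∂(lawW p n σ) = 0 := by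
    have hI : ∀ i : Fin p, Integrable (fun w => θ i * ∑ j, w i j * η j) (lawW p n σ) :=
      fun i => (aux_row p n η hη i).1.const_mul _
    refine ⟨integrable_finsetSum _ fun j _ => hI j, ?_⟩
    rw [hT3, integral_finsetSum _ fun j _ => hI j]
    refine Finset.sum_eq_zero fun i _ => ?_
    rw [integral_const_mul, (aux_row p n η hη i).2.1, mul_zero]
  have iq : Integrable (fun w => q w η) (lawW p n σ) ∧ ∫ w, q w η ∂(lawW p n σ) = n * σ ^ 2 * p := by
    have hI : ∀ i : Fin p, Integrable (fun w => (∑ j, w i j * η j) ^ 2) (lawW p n σ) :=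
      fun i => (aux_row p n η hη i).2.2.1
    refine ⟨integrable_finsetSum _ fun j _ => hI j, ?_⟩
    rw [hq, integral_finsetSum _ fun j _ => hI j]
    simp_rw [fun i => (aux_row p n (σ := σ) η hη i).2.2.2]
    simp
    ring
  have iA : Integrable (fun w => n * σ ^ 2 * (p + l⁻¹ * (T2 w + (c - 1)))) (lawW p n σ) :=
    ((integrable_const _).add ((iT2.1.add (integrable_const _)).const_mul _)).const_mul _
  have hrisk : risk p n σ f θ η
      = ∫ w, lossR (f (fun i j => θ i * η j + w i j)) η ∂(lawW p n σ) := by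
    unfold risk
    rw [aux_lawY_map, integral_map hmeas.aemeasurable]
    exact ((aux_loss_meas η).comp hf).aestronglyMeasurable
  have iL : Integrable (fun w => lossR (f (fun i j => θ i * η j + w i j)) η) (lawW p n σ) :=
    aux_loss_int (f := fun w => f (fun i j => θ i * η j + w i j)) (hf.comp hmeas) (fun y => hf2 _) hη _
  calc N * (n * risk p n σ f θ η)
      = ∫ w, N * (n * lossR (f (fun i j => θ i * η j + w i j)) η) ∂(lawW p n σ) := by
        rw [integral_const_mul, integral_const_mul, hrisk]
    _ ≤ ∫ w, (T1 w + n * σ ^ 2 * (p + l⁻¹ * (T2 w + (c - 1))) - 2 * n * T3 w - q w η) ∂(lawW p n σ) := by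
        refine integral_mono ((iL.const_mul _).const_mul _) ?_ hpt
        exact ((iT1.1.add iA).sub (iT3.1.const_mul _)).sub iq.1
    _ = 2 * n ^ 2 * s + n * σ ^ 2 * (p + l⁻¹ * (∫ w, T2 w ∂(lawW p n σ) + (c - 1)))
          - 2 * n * 0 - n * σ ^ 2 * p := by
        have j1 : Integrable (fun w => T1 w + n * σ ^ 2 * (p + l⁻¹ * (T2 w + (c - 1))))
          (lawW p n σ) := iT1.1.add iA
        have j2 : Integrable (fun w => 2 * n * T3 w) (lawW p n σ) := iT3.1.const_mul _
        have j3 : Integrable (fun w => T1 w + n * σ ^ 2 * (p + l⁻¹ * (T2 w + (c - 1)))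
          - 2 * n * T3 w) (lawW p n σ) := j1.sub j2
        have j4 : Integrable (fun w => T2 w + (c - 1)) (lawW p n σ) :=
          iT2.1.add (integrable_const _)
        have j5 : Integrable (fun w => l⁻¹ * (T2 w + (c - 1))) (lawW p n σ) := j4.const_mul _
        rw [integral_sub j3 iq.1, integral_sub j1 j2, integral_add iT1.1 iA,
          integral_const_mul, integral_const_mul, iT1.2, iT3.2, iq.2,
          integral_add (integrable_const _) j5,
          integral_const_mul, integral_add iT2.1 (integrable_const _)]
        simp
    _ ≤ 2 * n ^ 2 * s + n * σ ^ 2 * (p + l⁻¹ * (1 + (c - 1))) - 2 * n * 0 - n * σ ^ 2 * p := by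
        gcongr
        exact iT2.2
    _ = _ := by field_simp; ring


lemma aux_upper2 {p n : ℕ} (hp : 1 ≤ p) (hn : 0 < n) {σ Δ : ℝ} (hσ : 0 < σ) (hΔ : 0 < Δ)
    {θ : Fin p → ℝ} {η : Fin n → ℝ}
    (hη : η ∈ pmOne n) (hN : Δ ≤ eucNorm θ)
    {f : (Fin p → Fin n → ℝ) → Fin n → ℝ} (hf : Measurable f) (hf2 : ∀ y, f y ∈ pmOne n)
    (hf3 : ∀ y, ∀ a ∈ pmOne n, ∑ i, (∑ j, y i j * a j) ^ 2 ≤ ∑ i, (∑ j, y i j * f y j) ^ 2) :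
    (n : ℝ)⁻¹ * risk p n σ f θ η ≤ 2 * √(σ ^ 2 * (1 + √((p : ℝ) / n)) / Δ ^ 2)
      + 4 * (σ ^ 2 * (1 + √((p : ℝ) / n)) / Δ ^ 2) := by
  have hn' : (0 : ℝ) < n := by exact_mod_cast hn
  have hp' : (0 : ℝ) < p := by exact_mod_cast hp
  set N := ∑ i, θ i ^ 2 with hNd
  set t := √N with ht
  have hE : eucNorm θ = t := rfl
  rw [hE] at hN
  have ht0 : 0 < t := lt_of_lt_of_le hΔ hN
  have hN0 : 0 < N := Real.sqrt_pos.1 ht0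
  have htN : t ^ 2 = N := Real.sq_sqrt hN0.le
  set r := √((p : ℝ) / n) with hr
  have hr0 : 0 < r := by positivity
  have hr2 : r ^ 2 = p / n := Real.sq_sqrt (by positivity)
  have hlog := Real.log_two_lt_d9
  have hlog0 := Real.log_two_gt_d9
  obtain ⟨l, h0, h1, hl⟩ : ∃ l : ℝ, 0 < l ∧ l ≤ 1 / 4 ∧
      Real.log 2 / l + 2 * l * r ^ 2 ≤ 4 * (1 + r) := by
    rcases le_total r 1 with h | h
    · refine ⟨1 / 4, by norm_num, le_rfl, ?_⟩
      have : r ^ 2 ≤ r := by nlinarith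
      nlinarith
    · refine ⟨1 / (4 * r), by positivity, ?_, ?_⟩
      · rw [div_le_div_iff₀ (by positivity) (by norm_num)]; linarith
      · have e : Real.log 2 / (1 / (4 * r)) + 2 * (1 / (4 * r)) * r ^ 2
            = 4 * r * Real.log 2 + r / 2 := by field_simp; ring
        rw [e]; nlinarith
  have hu := aux_upper hn hσ hη hN0 hf hf2 hf3 h0 h1
  rw [← hNd, ← ht] at hu
  have key : (n : ℝ)⁻¹ * risk p n σ f θ η ≤ 2 * (σ / t) + (σ / t) ^ 2 * (4 * (1 + r)) := by
    have e1 : (2 * n ^ 2 * (σ * t) + n * σ ^ 2 * (n * Real.log 2 + 2 * l ^ 2 * p) / l) / (N * n ^ 2)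
        = 2 * (σ / t) + (σ / t) ^ 2 * (Real.log 2 / l + 2 * l * r ^ 2) := by
      rw [hr2, ← htN]; field_simp
    have e2 : (n : ℝ)⁻¹ * risk p n σ f θ η = N * (n * risk p n σ f θ η) / (N * n ^ 2) := by
      field_simp
    rw [e2]
    refine (div_le_div_of_nonneg_right hu (by positivity)).trans ?_
    rw [e1]
    gcongr
  refine key.trans ?_
  have h3 : σ / t ≤ σ / Δ := by gcongr
  have h4 : σ / Δ ≤ √(σ ^ 2 * (1 + r) / Δ ^ 2) := by
    apply Real.le_sqrt_of_sq_le
    rw [div_pow]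
    gcongr
    nlinarith [sq_nonneg σ]
  have h5 : (σ / t) ^ 2 * (4 * (1 + r)) ≤ 4 * (σ ^ 2 * (1 + r) / Δ ^ 2) := by
    calc _ ≤ (σ / Δ) ^ 2 * (4 * (1 + r)) := by gcongr
      _ = _ := by field_simp
  linarith

lemma aux_part1 (p : ℕ → ℕ) (σ Δ : ℕ → ℝ)
    (hp : ∀ n, 1 ≤ p n) (hσ : ∀ n, 0 < σ n) (hΔ : ∀ n, 0 < Δ n) 
    (h : (fun n => σ n ^ 2 * (1 + Real.sqrt ((p n : ℝ) / n))) =o[atTop] fun n => Δ n ^ 2) :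
      ∃ est : (n : ℕ) → (Fin (p n) → Fin n → ℝ) → Fin n → ℝ,
        (∀ n, Measurable (est n)) ∧ (∀ n y, est n y ∈ pmOne n) ∧
        Tendsto (fun n => ⨆ x : Omega (p n) n (Δ n),
          (n : ℝ)⁻¹ * risk (p n) n (σ n) (est n) x.1.1 x.1.2) atTop (nhds 0) := by
  choose est hm hest using fun n => aux_est (p n) n
  refine ⟨est, hm, fun n y => (hest n y).1, ?_⟩
  have hg := h.tendsto_div_nhds_zero
  have hlim : Tendsto (fun n => 2 * √(σ n ^ 2 * (1 + √((p n : ℝ) / n)) / Δ n ^ 2)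
      + 4 * (σ n ^ 2 * (1 + √((p n : ℝ) / n)) / Δ n ^ 2)) atTop (nhds 0) := by
    have := (hg.sqrt.const_mul 2).add (hg.const_mul 4)
    simpa using this
  refine squeeze_zero' (Eventually.of_forall fun n => ?_) ?_ hlim
  · exact Real.iSup_nonneg fun x => (aux_risk_bd (hm n) (fun y => (hest n y).1) x.2.2 _ _).1
  · filter_upwards [eventually_gt_atTop 0] with n hn
    refine Real.iSup_le (fun x => ?_) (by positivity)
    exact aux_upper2 (hp n) hn (hσ n) (hΔ n) x.2.2 x.2.1 (hm n) (fun y => (hest n y).1)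
      (fun y => (hest n y).2)


lemma aux_tanh (A B : ℝ) :
    (Real.cosh A * Real.cosh B) ^ 2 * Real.exp (-(Real.tanh A ^ 2 * B ^ 2))
      ≤ Real.cosh (A + B) * Real.cosh (A - B) := by
  have hA := Real.cosh_pos A
  have hB := Real.cosh_pos B
  have sA := Real.cosh_sq A
  have sB := Real.cosh_sq B
  set a := Real.tanh A ^ 2 with ha
  set b := Real.tanh B ^ 2 with hb
  have ha' : a = Real.sinh A ^ 2 / Real.cosh A ^ 2 := by rw [ha, Real.tanh_eq_sinh_div_cosh, div_pow]
  have hb' : b = Real.sinh B ^ 2 / Real.cosh B ^ 2 := by rw [hb, Real.tanh_eq_sinh_div_cosh, div_pow]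
  have ha1 : a ≤ 1 := by rw [ha', div_le_one (by positivity)]; linarith
  have hb1 : 1 - b = (Real.cosh B ^ 2)⁻¹ := by
    rw [hb']; field_simp; linarith
  have e1 : Real.cosh (A + B) * Real.cosh (A - B)
      = (Real.cosh A * Real.cosh B) ^ 2 * (1 - a * b) := by
    rw [Real.cosh_add, Real.cosh_sub, ha', hb']; field_simp
    ring
  rw [e1]
  gcongr
  have hcb : Real.exp (-B ^ 2) ≤ 1 - b := by
    rw [hb1, neg_eq_neg_one_mul, ← neg_eq_neg_one_mul, Real.exp_neg]
    apply inv_anti₀ (by positivity)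
    calc Real.cosh B ^ 2 ≤ (Real.exp (B ^ 2 / 2)) ^ 2 := by
          gcongr; exact Real.cosh_le_exp_half_sq B
      _ = _ := by rw [← Real.exp_nat_mul]; congr 1; push_cast; ring
  have h0 : 0 ≤ 1 - b := by rw [hb1]; positivity
  have hbern := rpow_one_add_le_one_add_mul_self (s := -b) (by linarith) (p := a) (by positivity) ha1
  calc Real.exp (-(a * B ^ 2)) = (Real.exp (-B ^ 2)) ^ a := by
        rw [← Real.exp_mul]; congr 1; ring
    _ ≤ (1 - b) ^ a := Real.rpow_le_rpow (Real.exp_pos _).le hcb (by positivity)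
    _ ≤ 1 - a * b := by rw [← sub_eq_add_neg] at hbern; linarith

lemma aux_tanh_sq_le (A : ℝ) : Real.tanh A ^ 2 ≤ 1 ∧ Real.tanh A ^ 2 ≤ A ^ 2 := by
  have hA := Real.cosh_pos A
  have sA := Real.cosh_sq A
  rw [Real.tanh_eq_sinh_div_cosh, div_pow]
  constructor
  · rw [div_le_one (by positivity)]; linarith
  · rw [div_le_iff₀ (by positivity)]
    have h1 : |Real.sinh A| ≤ |A| * Real.cosh A := by
      rw [Real.abs_sinh, ← Real.cosh_abs A]
      set t := |A|
      have ht : 0 ≤ t := abs_nonneg A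
      have := Convex.norm_image_sub_le_of_norm_deriv_le (f := Real.sinh) (C := Real.cosh t)
        (s := Set.Icc 0 t) (x := 0) (y := t) (fun x _ => Real.differentiable_sinh x)
        (fun x hx => by
          rw [Real.deriv_sinh, Real.norm_eq_abs, abs_of_pos (Real.cosh_pos x), Real.cosh_le_cosh,
            abs_of_nonneg hx.1, abs_of_nonneg ht]
          exact hx.2) (convex_Icc 0 t) (by simp [ht]) (by simp [ht])
      simp only [Real.sinh_zero, sub_zero, Real.norm_eq_abs, abs_of_nonneg ht] at this
      have := (le_abs_self _).trans this
      linarith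
    have := pow_le_pow_left₀ (abs_nonneg _) h1 2
    rw [mul_pow, sq_abs, sq_abs] at this
    exact this

lemma aux_min {a b z s : ℝ} (ha : 0 ≤ a) (hb : 0 ≤ b) (hs : 0 < s) (h : z ^ 2 ≤ a * b) :
    2 / s * z - (a + b) / s ^ 2 ≤ min a b := by
  have key : ∀ a b : ℝ, 0 ≤ a → 0 ≤ b → a ≤ b → z ^ 2 ≤ a * b →
      2 / s * z - (a + b) / s ^ 2 ≤ a := by
    intro a b ha hb hab h
    have h1 : 2 * s * z ≤ s ^ 2 * a + b := by
      apply le_of_sq_le_sq _ (by positivity)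
      nlinarith [sq_nonneg (s ^ 2 * a - b), sq_nonneg s, mul_le_mul_of_nonneg_left h (sq_nonneg s)]
    have e : 2 / s * z - (a + b) / s ^ 2 = (2 * s * z - (a + b)) / s ^ 2 := by field_simp
    rw [e, div_le_iff₀ (by positivity)]
    linarith
  rcases le_total a b with hab | hab
  · rw [min_eq_left hab]; exact key a b ha hb hab h
  · rw [min_eq_right hab, add_comm a b]; exact key b a hb ha hab (by linarith)

lemma aux_prod_sum {p : ℕ} {E : Type*} [MeasurableSpace E] (ν : Measure E) [IsProbabilityMeasure ν]
    (ψ U : E → ℝ) (k : ℝ) (h1 : Integrable ψ ν) (h2 : ∫ y, ψ y ∂ν = 1)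
    (h3 : Integrable (fun y => ψ y * U y) ν) (h4 : ∫ y, ψ y * U y ∂ν = k) :
    Integrable (fun w : Fin p → E => (∏ i, ψ (w i)) * ∑ i, U (w i)) (Measure.pi fun _ => ν) ∧
    ∫ w : Fin p → E, (∏ i, ψ (w i)) * ∑ i, U (w i) ∂(Measure.pi fun _ => ν) = p * k := by
  classical
  have e : ∀ w : Fin p → E, (∏ i, ψ (w i)) * ∑ i, U (w i)
      = ∑ l, ∏ i, (if i = l then fun y => ψ y * U y else ψ) (w i) := by
    intro w
    rw [Finset.mul_sum]
    refine Finset.sum_congr rfl fun l _ => ?_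
    rw [← Finset.mul_prod_erase univ _ (Finset.mem_univ l),
      ← Finset.mul_prod_erase univ (fun i => (if i = l then fun y => ψ y * U y else ψ) (w i)) (Finset.mem_univ l)]
    simp only [if_true]
    have h : ∏ i ∈ univ.erase l, (if i = l then fun y => ψ y * U y else ψ) (w i)
        = ∏ i ∈ univ.erase l, ψ (w i) := Finset.prod_congr rfl (fun i hi => by
      rw [if_neg (Finset.ne_of_mem_erase hi)])
    rw [h]
    ring
  simp_rw [e]
  have hI : ∀ l : Fin p, Integrable (fun w : Fin p → E =>
      ∏ i, (if i = l then fun y => ψ y * U y else ψ) (w i)) (Measure.pi fun _ => ν) := by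
    intro l
    refine Integrable.fintype_prod (f := fun i => if i = l then fun y => ψ y * U y else ψ) fun i => ?_
    split_ifs <;> assumption
  refine ⟨integrable_finsetSum _ fun l _ => hI l, ?_⟩
  rw [integral_finsetSum _ fun l _ => hI l]
  have : ∀ l : Fin p, ∫ w : Fin p → E,
      ∏ i, (if i = l then fun y => ψ y * U y else ψ) (w i) ∂(Measure.pi fun _ => ν) = k := by
    intro l
    rw [integral_fintype_prod_eq_prod (fun i => if i = l then fun y => ψ y * U y else ψ)]
    rw [Finset.prod_eq_single l]
    · simpa using h4
    · intro i _ hi; simp only [if_neg hi]; exact h2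
    · simp
  simp [this]

lemma aux_row_indep {n : ℕ} {v : ℝ≥0} (a : Fin n → ℝ) (j : Fin n) (wA wB : ℝ≥0)
    (hA : (∑ k ∈ univ.erase j, NNReal.mk (a k ^ 2) (sq_nonneg _) * v) = wA)
    (hB : NNReal.mk (a j ^ 2) (sq_nonneg _) * v = wB)
    (F G : ℝ → ℝ) (mF : Measurable F) (mG : Measurable G)
    (iF : Integrable F (gaussianReal 0 wA)) (iG : Integrable G (gaussianReal 0 wB)) :
    Integrable (fun y : Fin n → ℝ => F (∑ k ∈ univ.erase j, a k * y k) * G (a j * y j))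
      (Measure.pi fun _ => gaussianReal 0 v) ∧
    ∫ y : Fin n → ℝ, F (∑ k ∈ univ.erase j, a k * y k) * G (a j * y j)
      ∂(Measure.pi fun _ => gaussianReal 0 v)
      = (∫ z, F z ∂(gaussianReal 0 wA)) * ∫ z, G z ∂(gaussianReal 0 wB) := by
  have lA := aux_lin_law n v a (univ.erase j)
  have lB := aux_lin_law n v a {j}
  simp only [Finset.sum_singleton] at lB
  rw [hA] at lA
  rw [hB] at lB
  have hi := iIndepFun_pi (μ := fun _ : Fin n => gaussianReal 0 v) (X := fun k x => a k * x)
    (fun k => by fun_prop)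
  have h1 := hi.indepFun_finsetSum_of_notMem (fun k => by fun_prop) (Finset.notMem_erase j univ)
  have e : (∑ k ∈ univ.erase j, fun ω : Fin n → ℝ => a k * ω k)
      = fun ω => ∑ k ∈ univ.erase j, a k * ω k := by ext; simp
  rw [e] at h1
  have mA : Measurable (fun y : Fin n → ℝ => ∑ k ∈ univ.erase j, a k * y k) := by fun_prop
  have mB : Measurable (fun y : Fin n → ℝ => a j * y j) := by fun_prop
  have h2 := h1.comp mF mG
  rw [← lA] at iF
  rw [← lB] at iG
  rw [← lA, ← lB, integral_map mA.aemeasurable mF.aestronglyMeasurable,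
    integral_map mB.aemeasurable mG.aestronglyMeasurable]
  rw [integrable_map_measure mF.aestronglyMeasurable mA.aemeasurable] at iF
  rw [integrable_map_measure mG.aestronglyMeasurable mB.aemeasurable] at iG
  refine ⟨h2.integrable_mul iF iG, ?_⟩
  exact h2.integral_fun_mul_eq_mul_integral iF.1 iG.1


def Lf {p n : ℕ} (c X : ℝ) (η : Fin n → ℝ) (y : Fin p → Fin n → ℝ) : ℝ :=
  ∏ i, (Real.exp (-(n * X / 2)) * Real.cosh (∑ k, c * η k * y i k))

lemma Lf_nonneg {p n : ℕ} (c X : ℝ) (η : Fin n → ℝ) (y : Fin p → Fin n → ℝ) :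
    0 ≤ Lf c X η y :=
  Finset.prod_nonneg fun _ _ => mul_nonneg (Real.exp_pos _).le (Real.cosh_pos _).le

lemma Lf_meas {p n : ℕ} (c X : ℝ) (η : Fin n → ℝ) :
    Measurable (fun y : Fin p → Fin n → ℝ => Lf c X η y) := by
  unfold Lf
  refine Finset.measurable_prod _ fun i _ => ?_
  refine Measurable.const_mul (Real.measurable_cosh.comp (by fun_prop)) _

lemma aux_coef {n : ℕ} {v X : ℝ≥0} {c : ℝ} (hX : X = NNReal.mk (c ^ 2) (sq_nonneg _) * v)
    {η : Fin n → ℝ} (hη : η ∈ pmOne n) (k : Fin n) :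
    NNReal.mk ((c * η k) ^ 2) (sq_nonneg _) * v = X := by
  rw [hX]; congr 2
  rcases hη k with h | h <;> rw [h] <;> ring

lemma aux_L_int {p n : ℕ} (hn : 2 ≤ n) {v X : ℝ≥0} {c : ℝ}
    (hX : X = NNReal.mk (c ^ 2) (sq_nonneg _) * v) (hX0 : X ≠ 0)
    {η : Fin n → ℝ} (hη : η ∈ pmOne n) :
    Integrable (fun y : Fin p → Fin n → ℝ => Lf c X η y)
      (Measure.pi fun _ => Measure.pi fun _ => gaussianReal 0 v) ∧
    ∫ y : Fin p → Fin n → ℝ, Lf c X η y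
      ∂(Measure.pi fun _ => Measure.pi fun _ => gaussianReal 0 v) = 1 := by
  have hl := aux_lin_law n v (fun k => c * η k) univ
  simp only [aux_coef hX hη, sum_const, card_univ, Fintype.card_fin] at hl
  have hw : n • X ≠ 0 := by
    rw [nsmul_eq_mul]; exact mul_ne_zero (by norm_cast; omega) hX0
  obtain ⟨i1, i2⟩ := aux_cosh_one hw
  have mA : Measurable (fun y : Fin n → ℝ => ∑ k, c * η k * y k) := by fun_prop
  have mc : Measurable Real.cosh := Real.measurable_cosh
  rw [← hl, integrable_map_measure mc.aestronglyMeasurable mA.aemeasurable] at i1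
  rw [← hl, integral_map mA.aemeasurable mc.aestronglyMeasurable] at i2
  unfold Lf
  constructor
  · exact Integrable.fintype_prod
      (f := fun _ (y : Fin n → ℝ) => Real.exp (-(n * X / 2)) * Real.cosh (∑ k, c * η k * y k))
      fun i => i1.const_mul _
  · rw [integral_fintype_prod_eq_prod
      (fun _ (y : Fin n → ℝ) => Real.exp (-(n * X / 2)) * Real.cosh (∑ k, c * η k * y k))]
    apply Finset.prod_eq_one
    intro i _
    rw [integral_const_mul, i2, ← Real.exp_add]
    simp

lemma aux_key {p n : ℕ} (hn : 2 ≤ n) {v X : ℝ≥0} {c : ℝ}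
    (hX : X = NNReal.mk (c ^ 2) (sq_nonneg _) * v) (hX0 : X ≠ 0)
    {η : Fin n → ℝ} (hη : η ∈ pmOne n) (j : Fin n) (η' : Fin n → ℝ) (hη' : η' ∈ pmOne n)
    (hj : η' j = - η j) (hk : ∀ k, k ≠ j → η' k = η k)
    (g : ℝ → ℝ) (mg : Measurable g) (hg : ∀ z, Real.tanh z ^ 2 ≤ g z) (G : ℝ)
    (ig : Integrable (fun z => Real.cosh z * g z) (gaussianReal 0 ((n - 1 : ℕ) * X)))
    (eg : ∫ z, Real.cosh z * g z ∂(gaussianReal 0 ((n - 1 : ℕ) * X))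
      = Real.exp (((n - 1 : ℕ) * X : ℝ≥0) / 2) * G) :
    1 / 2 * Real.exp (-(p * (G * (X + X ^ 2)))) ≤
    ∫ y : Fin p → Fin n → ℝ, min (Lf c X η y) (Lf c X η' y)
      ∂(Measure.pi fun _ => Measure.pi fun _ => gaussianReal 0 v) := by
  set wA : ℝ≥0 := (n - 1 : ℕ) * X with hwA
  have hw : wA ≠ 0 := mul_ne_zero (by norm_cast; omega) hX0
  have hA : (∑ k ∈ univ.erase j, NNReal.mk ((c * η k) ^ 2) (sq_nonneg _) * v) = wA := by
    simp only [aux_coef hX hη, sum_const, card_erase_of_mem (mem_univ j), card_univ,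
      Fintype.card_fin, nsmul_eq_mul, hwA]
  have hB := aux_coef hX hη j
  obtain ⟨c1, c2⟩ := aux_cosh_one hw
  obtain ⟨d1, d2⟩ := aux_cosh_one hX0
  obtain ⟨e1, e2⟩ := aux_cosh_sq hX0
  have mc : Measurable Real.cosh := Real.measurable_cosh
  set A : (Fin n → ℝ) → ℝ := fun y => ∑ k ∈ univ.erase j, c * η k * y k with hAd
  set B : (Fin n → ℝ) → ℝ := fun y => c * η j * y j with hBd
  have hnX : (wA : ℝ) + X = n * X := by
    have h1 : ((n - 1 : ℕ) : ℝ) = n - 1 := by rw [Nat.cast_sub (by omega : 1 ≤ n)]; simp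
    rw [hwA, NNReal.coe_mul, NNReal.coe_natCast, h1]; ring
  set E := Real.exp (-(n * X / 2)) with hE
  have hEE : E * (Real.exp (wA / 2) * Real.exp (X / 2)) = 1 := by
    rw [hE, ← Real.exp_add, ← Real.exp_add, ← Real.exp_zero]; congr 1; linarith
  obtain ⟨f1, f2⟩ := aux_row_indep (fun k => c * η k) j wA X hA hB _ _ mc mc c1 d1
  obtain ⟨g1, g2⟩ := aux_row_indep (fun k => c * η k) j wA X hA hB _ _ (mc.mul mg)
    (mc.mul (measurable_id.pow_const 2)) ig e1
  obtain ⟨l1, l2⟩ := aux_L_int (p := p) hn hX hX0 hη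
  obtain ⟨l1', l2'⟩ := aux_L_int (p := p) hn hX hX0 hη'
  set ψ : (Fin n → ℝ) → ℝ := fun y => E * (Real.cosh (A y) * Real.cosh (B y)) with hψ
  set U : (Fin n → ℝ) → ℝ := fun y => g (A y) * B y ^ 2 with hU
  have p1 : Integrable ψ (Measure.pi fun _ => gaussianReal 0 v) := f1.const_mul E
  have p2 : ∫ y, ψ y ∂(Measure.pi fun _ => gaussianReal 0 v) = 1 := by
    rw [hψ, integral_const_mul, f2, c2, d2, hEE]
  have eU : ∀ y, ψ y * U y = E * ((Real.cosh (A y) * g (A y)) * (Real.cosh (B y) * B y ^ 2)) := by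
    intro y; simp only [hψ, hU]; ring
  have p3 : Integrable (fun y => ψ y * U y) (Measure.pi fun _ => gaussianReal 0 v) := by
    simp_rw [eU]; exact g1.const_mul E
  have p4 : ∫ y, ψ y * U y ∂(Measure.pi fun _ => gaussianReal 0 v) = G * (X + X ^ 2) := by
    simp_rw [eU]
    rw [integral_const_mul]
    refine (congrArg (fun t => E * t) g2).trans ?_
    simp only [Pi.mul_apply]
    have : ∫ z, Real.cosh z * (fun z => z ^ 2) z ∂(gaussianReal 0 X) = _ := e2
    rw [eg]
    simp only [id] at *
    rw [e2]
    linear_combination (G * (X + X ^ 2)) * hEE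
  obtain ⟨q1, q2⟩ := aux_prod_sum (p := p) _ ψ U _ p1 p2 p3 p4
  have r1 : Integrable (fun w : Fin p → Fin n → ℝ => ∏ i, ψ (w i))
      (Measure.pi fun _ => Measure.pi fun _ => gaussianReal 0 v) :=
    Integrable.fintype_prod (f := fun _ => ψ) fun i => p1
  have r2 : ∫ w : Fin p → Fin n → ℝ, ∏ i, ψ (w i)
      ∂(Measure.pi fun _ => Measure.pi fun _ => gaussianReal 0 v) = 1 := by
    rw [integral_fintype_prod_eq_prod (fun _ => ψ)]
    exact Finset.prod_eq_one fun i _ => p2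
  set κ : ℝ := p * (G * (X + X ^ 2)) / 2 with hκ
  set s : ℝ := 2 * Real.exp κ with hs
  have hspos : 0 < s := by positivity
  have sAB : ∀ y : Fin n → ℝ, ∑ k, c * η k * y k = A y + B y := by
    intro y
    rw [← Finset.sum_erase_add _ _ (mem_univ j)]
  have sAB' : ∀ y : Fin n → ℝ, ∑ k, c * η' k * y k = A y - B y := by
    intro y
    rw [← Finset.sum_erase_add _ _ (mem_univ j)]
    have : ∑ k ∈ univ.erase j, c * η' k * y k = A y :=
      Finset.sum_congr rfl fun k hk' => by rw [hk k (Finset.ne_of_mem_erase hk')]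
    rw [this, hj]; simp only [hBd]; ring
  have pw : ∀ w : Fin p → Fin n → ℝ,
      2 / s * Real.exp (-κ) * ((1 + κ) * (∏ i, ψ (w i)) - 1 / 2 * ((∏ i, ψ (w i)) * ∑ i, U (w i)))
        - (Lf c X η w + Lf c X η' w) / s ^ 2 ≤ min (Lf c X η w) (Lf c X η' w) := by
    intro w
    have hψ0 : 0 ≤ ∏ i, ψ (w i) := Finset.prod_nonneg fun i _ => by positivity
    have hz : ((∏ i, ψ (w i)) * Real.exp (-(∑ i, U (w i)) / 2)) ^ 2
        ≤ Lf c X η w * Lf c X η' w := by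
      have : ((∏ i, ψ (w i)) * Real.exp (-(∑ i, U (w i)) / 2)) ^ 2
          = ∏ i, (ψ (w i) ^ 2 * Real.exp (-U (w i))) := by
        have e3 : ∏ i, (ψ (w i) ^ 2 * Real.exp (-U (w i)))
            = (∏ i, ψ (w i) ^ 2) * ∏ i, Real.exp (-U (w i)) := Finset.prod_mul_distrib
        rw [e3, ← Real.exp_sum, mul_pow, Finset.prod_pow,
          ← Real.exp_nat_mul, Finset.sum_neg_distrib]
        congr 2; push_cast; ring
      rw [this]; unfold Lf
      rw [← Finset.prod_mul_distrib]
      apply Finset.prod_le_prod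
      · intro i _; positivity
      · intro i _
        rw [sAB, sAB']
        have h1 := aux_tanh (A (w i)) (B (w i))
        have h2 : Real.exp (-U (w i)) ≤ Real.exp (-(Real.tanh (A (w i)) ^ 2 * B (w i) ^ 2)) := by
          apply Real.exp_le_exp.mpr
          have := mul_le_mul_of_nonneg_right (hg (A (w i))) (sq_nonneg (B (w i)))
          simp only [hU]; linarith
        calc ψ (w i) ^ 2 * Real.exp (-U (w i))
            ≤ ψ (w i) ^ 2 * Real.exp (-(Real.tanh (A (w i)) ^ 2 * B (w i) ^ 2)) := by gcongr
          _ = E ^ 2 * ((Real.cosh (A (w i)) * Real.cosh (B (w i))) ^ 2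
              * Real.exp (-(Real.tanh (A (w i)) ^ 2 * B (w i) ^ 2))) := by
                simp only [hψ]; ring
          _ ≤ E ^ 2 * (Real.cosh (A (w i) + B (w i)) * Real.cosh (A (w i) - B (w i))) := by gcongr
          _ = _ := by ring
    refine le_trans ?_ (aux_min (Lf_nonneg _ _ _ _) (Lf_nonneg _ _ _ _) hspos hz)
    apply sub_le_sub_right
    rw [mul_assoc]
    apply mul_le_mul_of_nonneg_left _ (by positivity)
    have he : Real.exp (-κ) * (1 + κ - (∑ i, U (w i)) / 2) ≤ Real.exp (-(∑ i, U (w i)) / 2) := by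
      have := Real.add_one_le_exp (κ - (∑ i, U (w i)) / 2)
      calc _ ≤ Real.exp (-κ) * Real.exp (κ - (∑ i, U (w i)) / 2) := by gcongr; linarith
        _ = _ := by rw [← Real.exp_add]; congr 1; ring
    calc _ = (∏ i, ψ (w i)) * (Real.exp (-κ) * (1 + κ - (∑ i, U (w i)) / 2)) := by ring
      _ ≤ _ := by gcongr
  have I1 := ((r1.const_mul (1 + κ)).sub (q1.const_mul (1 / 2))).const_mul (2 / s * Real.exp (-κ))
  have I2 := (l1.add l1').div_const (s ^ 2)
  have hmono := integral_mono (I1.sub I2) (l1.inf l1') pw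
  refine le_trans (le_of_eq ?_) hmono
  rw [integral_sub' I1 I2]
  simp only [Pi.sub_apply, Pi.add_apply]
  rw [integral_const_mul, integral_sub (r1.const_mul (1 + κ)) (q1.const_mul (1 / 2)),
    integral_const_mul, integral_const_mul, integral_div, integral_add l1 l1', r2, q2, l2, l2']
  have hκ2 : (p : ℝ) * (G * (X + X ^ 2)) = 2 * κ := by rw [hκ]; ring
  rw [hκ2, hs, show -(2 * κ) = -κ + -κ by ring, Real.exp_add, Real.exp_neg]
  have := Real.exp_pos κ
  field_simp
  ring


lemma aux_dens {p n : ℕ} {σ : ℝ} (hσ : 0 < σ) (τ : ℝ) (ε : Fin p → Bool) {η : Fin n → ℝ}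
    (hη : η ∈ pmOne n) :
    lawY p n σ (fun i => τ * sv ε i) η = (lawW p n σ).withDensity (fun y => ENNReal.ofReal
      (∏ i, Real.exp (sv ε i * (∑ k, τ / σ ^ 2 * η k * y i k) - n * (τ ^ 2 / σ ^ 2) / 2))) := by
  have hv : (σ ^ 2).toNNReal ≠ 0 := by
    rw [ne_eq, Real.toNNReal_eq_zero]; push Not; positivity
  have hvc : ((σ ^ 2).toNNReal : ℝ) = σ ^ 2 := Real.coe_toNNReal _ (sq_nonneg _)
  unfold lawY lawW
  have h1 : ∀ i, (Measure.pi fun j => gaussianReal (τ * sv ε i * η j) (σ ^ 2).toNNReal)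
      = (Measure.pi fun _ : Fin n => gaussianReal 0 (σ ^ 2).toNNReal).withDensity
        (fun y => ∏ j, ENNReal.ofReal (Real.exp ((τ * sv ε i * η j) * y j / (σ ^ 2).toNNReal
          - (τ * sv ε i * η j) ^ 2 / (2 * (σ ^ 2).toNNReal)))) := fun i =>
    aux_pi_density _ _ (fun j z => ENNReal.ofReal (Real.exp ((τ * sv ε i * η j) * z / (σ ^ 2).toNNReal
          - (τ * sv ε i * η j) ^ 2 / (2 * (σ ^ 2).toNNReal)))) (fun j => by fun_prop)
      (fun j => aux_gauss_density _ hv)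
  rw [aux_pi_density _ _ _ (fun i => by fun_prop) h1]
  congr 1
  ext y
  rw [ENNReal.ofReal_prod_of_nonneg (fun i _ => (Real.exp_pos _).le)]
  refine Finset.prod_congr rfl fun i _ => ?_
  rw [← ENNReal.ofReal_prod_of_nonneg (fun i _ => (Real.exp_pos _).le), ← Real.exp_sum, hvc]
  congr 2
  rw [Finset.sum_sub_distrib, Finset.mul_sum]
  congr 1
  · refine Finset.sum_congr rfl fun k _ => ?_
    field_simp
  · have : ∀ j, (τ * sv ε i * η j) ^ 2 = τ ^ 2 := by
      intro j
      rcases hη j with h | h <;> rcases sv_mem ε i with h' | h' <;> rw [h, h'] <;> ring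
    simp only [this, sum_const, card_univ, Fintype.card_fin, nsmul_eq_mul]
    field_simp

lemma aux_sumexp {p n : ℕ} (c X : ℝ) (η : Fin n → ℝ) (y : Fin p → Fin n → ℝ) :
    ∑ ε : Fin p → Bool, ∏ i, Real.exp (sv ε i * (∑ k, c * η k * y i k) - n * X / 2)
      = 2 ^ p * Lf c X η y := by
  classical
  have h := Finset.prod_univ_sum (fun _ : Fin p => (univ : Finset Bool))
    (fun i b => Real.exp ((if b then (1 : ℝ) else -1) * (∑ k, c * η k * y i k) - n * X / 2))
  rw [Fintype.piFinset_univ] at h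
  unfold sv
  rw [← h]
  unfold Lf
  have : (2 : ℝ) ^ p = ∏ _i : Fin p, (2 : ℝ) := by simp
  rw [this, ← Finset.prod_mul_distrib]
  refine Finset.prod_congr rfl fun i _ => ?_
  simp only [Fintype.sum_bool, if_true, Bool.false_eq_true, if_false]
  rw [Real.cosh_eq, one_mul, neg_one_mul, sub_eq_add_neg, sub_eq_add_neg, Real.exp_add, Real.exp_add]
  ring

lemma aux_mix {p n : ℕ} {σ : ℝ} (hσ : 0 < σ) (τ : ℝ) {η : Fin n → ℝ}
    (hη : η ∈ pmOne n) {f : (Fin p → Fin n → ℝ) → Fin n → ℝ} (hf : Measurable f)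
    (hf2 : ∀ y, f y ∈ pmOne n) :
    ∑ ε : Fin p → Bool, risk p n σ f (fun i => τ * sv ε i) η
      = 2 ^ p * ∫ y, Lf (τ / σ ^ 2) (τ ^ 2 / σ ^ 2) η y * lossR (f y) η ∂(lawW p n σ) := by
  set D : (Fin p → Bool) → (Fin p → Fin n → ℝ) → ℝ := fun ε y =>
    ∏ i, Real.exp (sv ε i * (∑ k, τ / σ ^ 2 * η k * y i k) - n * (τ ^ 2 / σ ^ 2) / 2) with hD
  have hD0 : ∀ ε y, 0 ≤ D ε y := fun ε y => Finset.prod_nonneg fun i _ => (Real.exp_pos _).le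
  have mD : ∀ ε, Measurable (D ε) := by
    intro ε
    refine Finset.measurable_prod _ fun i _ => ?_
    fun_prop
  have h1 : ∀ ε, Integrable (fun y => D ε y * lossR (f y) η) (lawW p n σ) ∧
      risk p n σ f (fun i => τ * sv ε i) η = ∫ y, D ε y * lossR (f y) η ∂(lawW p n σ) := by
    intro ε
    have hi := aux_loss_int hf hf2 hη (lawY p n σ (fun i => τ * sv ε i) η)
    unfold risk
    rw [aux_dens hσ τ ε hη] at hi ⊢
    have mO : Measurable (fun y => ENNReal.ofReal (D ε y)) := (mD ε).ennreal_ofReal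
    rw [integral_withDensity_eq_integral_toReal_smul mO (by simp)]
    rw [integrable_withDensity_iff_integrable_smul' mO (by simp)] at hi
    simp only [ENNReal.toReal_ofReal (hD0 ε _), smul_eq_mul] at hi ⊢
    exact ⟨hi, trivial⟩
  simp_rw [fun ε => (h1 ε).2]
  rw [← integral_finsetSum _ fun ε _ => (h1 ε).1, ← integral_const_mul]
  congr 1
  ext y
  rw [← Finset.sum_mul, aux_sumexp]
  ring

def fl {n : ℕ} (j : Fin n) (b : Fin n → Bool) : Fin n → Bool := Function.update b j (!b j)

lemma fl_fl {n : ℕ} (j : Fin n) (b : Fin n → Bool) : fl j (fl j b) = b := by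
  unfold fl; simp

lemma sv_fl {n : ℕ} (j : Fin n) (b : Fin n → Bool) : sv (fl j b) j = - sv b j := by
  unfold fl sv; cases h : b j <;> simp

lemma sv_fl_ne {n : ℕ} (j : Fin n) (b : Fin n → Bool) (k : Fin n) (hk : k ≠ j) :
    sv (fl j b) k = sv b k := by
  unfold fl sv; simp [hk]

lemma aux_pair {n : ℕ} (L : (Fin n → Bool) → ℝ) (j k : Fin n) (hjk : k ≠ j)
    {a : Fin n → ℝ} (ha : a ∈ pmOne n) :
    ∑ b, min (L b) (L (fl j b)) ≤ ∑ b, L b * (1 - a j * a k * sv b j * sv b k) := by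
  let e : (Fin n → Bool) ≃ (Fin n → Bool) := ⟨fl j, fl j, fl_fl j, fl_fl j⟩
  have h := Equiv.sum_comp e (fun b => L b * (1 - a j * a k * sv b j * sv b k))
  have h2 : ∑ b, L b * (1 - a j * a k * sv b j * sv b k)
      = ∑ b, (1 / 2) * (L b * (1 - a j * a k * sv b j * sv b k)
        + L (fl j b) * (1 + a j * a k * sv b j * sv b k)) := by
    rw [← Finset.mul_sum, Finset.sum_add_distrib]
    have h3 : ∑ b, L (fl j b) * (1 + a j * a k * sv b j * sv b k)
        = ∑ b, L b * (1 - a j * a k * sv b j * sv b k) := by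
      rw [← h]
      refine Finset.sum_congr rfl fun b _ => ?_
      change _ = L (fl j b) * (1 - a j * a k * sv (fl j b) j * sv (fl j b) k)
      rw [sv_fl, sv_fl_ne j b k hjk]; ring
    rw [h3]; ring
  rw [h2]
  refine Finset.sum_le_sum fun b _ => ?_
  have ht : a j * a k * sv b j * sv b k = 1 ∨ a j * a k * sv b j * sv b k = -1 := by
    rcases ha j with h | h <;> rcases ha k with h' | h' <;> rcases sv_mem b j with h'' | h'' <;>
      rcases sv_mem b k with h3 | h3 <;> rw [h, h', h'', h3] <;> norm_num
  rcases ht with h | h <;> rw [h]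
  · have := min_le_right (L b) (L (fl j b)); linarith
  · have := min_le_left (L b) (L (fl j b)); linarith

lemma aux_loss_lb {n : ℕ} {a b : Fin n → ℝ} (ha : a ∈ pmOne n) (hb : b ∈ pmOne n) :
    ∑ j, ∑ k ∈ univ.erase j, (1 - a j * a k * b j * b k) ≤ 2 * n * lossR a b := by
  rw [aux_loss a b ha hb]
  set m := ∑ j, a j * b j with hm
  have hmn : |m| ≤ n := aux_abs_le a b ha hb
  have h1 : ∑ j, ∑ k ∈ univ.erase j, (1 - a j * a k * b j * b k)
      ≤ ∑ j, ∑ k, (1 - a j * a k * b j * b k) := by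
    refine Finset.sum_le_sum fun j _ => ?_
    refine Finset.sum_le_sum_of_subset_of_nonneg (Finset.erase_subset _ _) fun k _ _ => ?_
    rcases ha j with h | h <;> rcases ha k with h' | h' <;> rcases hb j with h'' | h'' <;>
      rcases hb k with h3 | h3 <;> rw [h, h', h'', h3] <;> norm_num
  have h2 : ∑ j, ∑ k, (1 - a j * a k * b j * b k) = (n : ℝ) ^ 2 - m ^ 2 := by
    rw [hm, sq (∑ j, _), Finset.sum_mul_sum]
    simp only [Finset.sum_sub_distrib, sum_const, card_univ, Fintype.card_fin, nsmul_eq_mul, mul_one]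
    congr 1
    · ring
    · refine Finset.sum_congr rfl fun j _ => Finset.sum_congr rfl fun k _ => by ring
  have h3 := sq_abs m
  have h4 := abs_nonneg m
  nlinarith

lemma aux_avg {p n : ℕ} (hn : 2 ≤ n) {σ : ℝ} (hσ : 0 < σ) (τ β : ℝ)
    (hL : ∀ b : Fin n → Bool, Integrable
      (fun y : Fin p → Fin n → ℝ => Lf (τ / σ ^ 2) (τ ^ 2 / σ ^ 2) (sv b) y) (lawW p n σ))
    (hβ : ∀ (b : Fin n → Bool) (j : Fin n), β ≤ ∫ y : Fin p → Fin n → ℝ,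
      min (Lf (τ / σ ^ 2) (τ ^ 2 / σ ^ 2) (sv b) y)
        (Lf (τ / σ ^ 2) (τ ^ 2 / σ ^ 2) (sv (fl j b)) y) ∂(lawW p n σ)) (hβ0 : 0 ≤ β)
    {f : (Fin p → Fin n → ℝ) → Fin n → ℝ} (hf : Measurable f) (hf2 : ∀ y, f y ∈ pmOne n) :
    ∃ (ε : Fin p → Bool) (b : Fin n → Bool),
      β / 4 ≤ (n : ℝ)⁻¹ * risk p n σ f (fun i => τ * sv ε i) (sv b) := by
  have hn0 : (0 : ℝ) < n := by norm_cast; omega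
  have hn2 : (2 : ℝ) ≤ n := by exact_mod_cast hn
  set L : (Fin n → Bool) → (Fin p → Fin n → ℝ) → ℝ :=
    fun b y => Lf (τ / σ ^ 2) (τ ^ 2 / σ ^ 2) (sv b) y with hLd
  have pw : ∀ y, ((n : ℝ) - 1) * ∑ j, ∑ b, min (L b y) (L (fl j b) y)
      ≤ 2 * n * ∑ b, L b y * lossR (f y) (sv b) := by
    intro y
    calc ((n : ℝ) - 1) * ∑ j, ∑ b, min (L b y) (L (fl j b) y)
        = ∑ j, ∑ k ∈ univ.erase j, ∑ b, min (L b y) (L (fl j b) y) := by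
          simp only [sum_const, card_erase_of_mem (mem_univ _), card_univ, Fintype.card_fin,
            nsmul_eq_mul]
          rw [← Finset.mul_sum, Nat.cast_sub (by omega : 1 ≤ n)]; simp
      _ ≤ ∑ j, ∑ k ∈ univ.erase j, ∑ b, L b y * (1 - f y j * f y k * sv b j * sv b k) :=
          Finset.sum_le_sum fun j _ => Finset.sum_le_sum fun k hk =>
            aux_pair (fun b => L b y) j k (Finset.ne_of_mem_erase hk) (hf2 y)
      _ = ∑ b, L b y * ∑ j, ∑ k ∈ univ.erase j, (1 - f y j * f y k * sv b j * sv b k) := by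
          simp_rw [Finset.mul_sum]
          rw [Finset.sum_comm]
          rw [← Finset.sum_comm]
          simp_rw [Finset.sum_comm (s := univ.erase _) (t := (univ : Finset (Fin n → Bool)))]
          rw [Finset.sum_comm]
      _ ≤ ∑ b, L b y * (2 * n * lossR (f y) (sv b)) := by
          refine Finset.sum_le_sum fun b _ => mul_le_mul_of_nonneg_left
            (aux_loss_lb (hf2 y) (sv_mem b)) (Lf_nonneg _ _ _ _)
      _ = _ := by
          rw [Finset.mul_sum]; refine Finset.sum_congr rfl fun b _ => by ring
  have iM : ∀ j b, Integrable (fun y => min (L b y) (L (fl j b) y)) (lawW p n σ) :=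
    fun j b => (hL b).inf (hL (fl j b))
  have iQ : ∀ b, Integrable (fun y => L b y * lossR (f y) (sv b)) (lawW p n σ) := by
    intro b
    refine (hL b).mul_bdd (c := (n : ℝ)) ((aux_loss_meas (sv b)).comp hf).aestronglyMeasurable ?_
    refine Filter.Eventually.of_forall fun y => ?_
    have := aux_loss_bd (f y) (sv b) (hf2 y) (sv_mem b)
    rw [Real.norm_eq_abs, abs_of_nonneg this.1]; exact this.2
  have hmain := integral_mono
    ((integrable_finsetSum univ fun j _ => integrable_finsetSum univ fun b _ => iM j b).const_mul
      ((n : ℝ) - 1))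
    ((integrable_finsetSum univ fun b _ => iQ b).const_mul (2 * (n : ℝ))) pw
  rw [integral_const_mul, integral_const_mul, integral_finsetSum _ fun b _ => iQ b,
    integral_finsetSum _ fun j _ => integrable_finsetSum univ fun b _ => iM j b] at hmain
  simp_rw [fun j => integral_finsetSum (μ := lawW p n σ) univ fun b _ => iM j b] at hmain
  have hlow : (n : ℝ) * (2 ^ n * β) ≤ ∑ j, ∑ b, ∫ y, min (L b y) (L (fl j b) y) ∂(lawW p n σ) := by
    calc (n : ℝ) * (2 ^ n * β) = ∑ _j : Fin n, ∑ _b : Fin n → Bool, β := by simp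
      _ ≤ _ := Finset.sum_le_sum fun j _ => Finset.sum_le_sum fun b _ => hβ b j
  by_contra hcon
  push Not at hcon
  have hup : ∑ b, ∫ y, L b y * lossR (f y) (sv b) ∂(lawW p n σ) < 2 ^ n * (n * (β / 4)) := by
    have h2 : (2 : ℝ) ^ p * ∑ b, ∫ y, L b y * lossR (f y) (sv b) ∂(lawW p n σ)
        = ∑ b, ∑ ε : Fin p → Bool, risk p n σ f (fun i => τ * sv ε i) (sv b) := by
      rw [Finset.mul_sum]
      refine Finset.sum_congr rfl fun b _ => (aux_mix hσ τ (sv_mem b) hf hf2).symm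
    have h3 : ∑ b : Fin n → Bool, ∑ ε : Fin p → Bool, risk p n σ f (fun i => τ * sv ε i) (sv b)
        < ∑ b : Fin n → Bool, ∑ ε : Fin p → Bool, n * (β / 4) := by
      refine Finset.sum_lt_sum_of_nonempty univ_nonempty fun b _ =>
        Finset.sum_lt_sum_of_nonempty univ_nonempty fun ε _ => ?_
      have := hcon ε b
      rwa [inv_mul_lt_iff₀ hn0] at this
    have h4 : ∑ b : Fin n → Bool, ∑ ε : Fin p → Bool, (n * (β / 4) : ℝ)
        = 2 ^ p * (2 ^ n * (n * (β / 4))) := by simp; ring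
    rw [← h2, h4] at h3
    exact lt_of_mul_lt_mul_left h3 (by positivity)
  have h5 : ((n : ℝ) - 1) * (n * (2 ^ n * β)) < 2 * n * (2 ^ n * (n * (β / 4))) :=
    calc _ ≤ _ := mul_le_mul_of_nonneg_left hlow (by linarith)
      _ ≤ _ := hmain
      _ < _ := by gcongr
  have h6 : 0 ≤ (n : ℝ) * 2 ^ n * β := by positivity
  nlinarith


/-- the constant in the exponent of the lower bound -/
def KC (C : ℝ) : ℝ := 2 * C * (1 + 2 * C) + 4 * C ^ 2 * (1 + 2 * C) ^ 2

lemma aux_num1 {p n x q C : ℝ} (hp : 1 ≤ p) (hn : 1 ≤ n) (hq : q = √(p / n)) (hC : 1 ≤ C)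
    (hx : x = C * (1 + q) / p) (hpn : p ≤ n) : p * (1 * (x + x ^ 2)) ≤ KC C := by
  have hq1 : q ≤ 1 := by
    rw [hq, Real.sqrt_le_iff]
    exact ⟨zero_le_one, by rw [one_pow, div_le_one (by linarith)]; exact hpn⟩
  have hq0 : 0 ≤ q := hq ▸ Real.sqrt_nonneg _
  have hpx : p * x ≤ 2 * C := by
    rw [hx, mul_div_cancel₀ _ (by linarith)]; nlinarith
  have hx0 : 0 ≤ x := by rw [hx]; positivity
  have hx1 : x ≤ 2 * C := by nlinarith
  unfold KC
  have : p * (1 * (x + x ^ 2)) = (p * x) * (1 + x) := by ring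
  rw [this]
  have h1 : (p * x) * (1 + x) ≤ 2 * C * (1 + 2 * C) := by gcongr
  have h2 : 0 ≤ 4 * C ^ 2 * (1 + 2 * C) ^ 2 := by positivity
  linarith

lemma aux_num2 {p n x q C w : ℝ} (hp : 1 ≤ p) (hn : 1 ≤ n) (hq : q = √(p / n)) (hC : 1 ≤ C)
    (hx : x = C * (1 + q) / p) (hpn : n ≤ p) (hw0 : 0 ≤ w) (hw : w ≤ n * x) :
    p * ((w + w ^ 2) * (x + x ^ 2)) ≤ KC C := by
  have hq1 : 1 ≤ q := by
    rw [hq, Real.one_le_sqrt, one_le_div (by linarith)]; exact hpn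
  have hqq : n * q ^ 2 = p := by
    rw [hq, Real.sq_sqrt (by positivity)]; field_simp
  have hpx : p * x ≤ 2 * C * q := by
    rw [hx, mul_div_cancel₀ _ (by linarith)]; nlinarith
  have hx0 : 0 ≤ x := by rw [hx]; positivity
  have hx1 : n * x * q ≤ 2 * C := by
    have : (n * x * q) * q ≤ 2 * C * q := by
      calc _ = p * x := by rw [← hqq]; ring
        _ ≤ _ := hpx
    exact le_of_mul_le_mul_right this (by linarith)
  have hnx0 : 0 ≤ n * x := by positivity
  have hnx : n * x ≤ 2 * C := by nlinarith
  have hx2 : x ≤ 2 * C := by nlinarith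
  have hww : w ≤ 2 * C := hw.trans hnx
  have h3 : (p * x) * w ≤ 4 * C ^ 2 := by
    calc (p * x) * w ≤ (2 * C * q) * (n * x) := by gcongr
      _ = 2 * C * (n * x * q) := by ring
      _ ≤ 2 * C * (2 * C) := by gcongr
      _ = _ := by ring
  unfold KC
  have : p * ((w + w ^ 2) * (x + x ^ 2)) = (p * x * w) * ((1 + w) * (1 + x)) := by ring
  rw [this]
  have h1 : (p * x * w) * ((1 + w) * (1 + x)) ≤ 4 * C ^ 2 * ((1 + 2 * C) * (1 + 2 * C)) := by gcongr
  have h2 : 0 ≤ 2 * C * (1 + 2 * C) := by positivity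
  nlinarith

lemma aux_lower {p n : ℕ} (hp : 1 ≤ p) (hn : 2 ≤ n) {σ Δ C : ℝ} (hσ : 0 < σ) (hΔ : 0 < Δ)
    (hC : 1 ≤ C) (h : Δ ^ 2 ≤ C * (σ ^ 2 * (1 + √((p : ℝ) / n))))
    {f : (Fin p → Fin n → ℝ) → Fin n → ℝ} (hf : Measurable f) (hf2 : ∀ y, f y ∈ pmOne n) :
    (1 / 2 * Real.exp (-KC C)) / 4 ≤
      ⨆ x : Omega p n Δ, (n : ℝ)⁻¹ * risk p n σ f x.1.1 x.1.2 := by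
  have hp1 : (1 : ℝ) ≤ p := by exact_mod_cast hp
  have hn1 : (1 : ℝ) ≤ n := by norm_cast; omega
  set q := √((p : ℝ) / n) with hq
  have hq0 : 0 ≤ q := Real.sqrt_nonneg _
  set τ := √(C * (σ ^ 2 * (1 + q)) / p) with hτ
  have hτ2 : τ ^ 2 = C * (σ ^ 2 * (1 + q)) / p := Real.sq_sqrt (by positivity)
  have hτ0 : 0 < τ := Real.sqrt_pos.mpr (by positivity)
  have hv : ((σ ^ 2).toNNReal : ℝ) = σ ^ 2 := Real.coe_toNNReal _ (sq_nonneg _)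
  set X : ℝ≥0 := NNReal.mk ((τ / σ ^ 2) ^ 2) (sq_nonneg _) * (σ ^ 2).toNNReal with hX
  have hXr : (X : ℝ) = τ ^ 2 / σ ^ 2 := by
    rw [hX, NNReal.coe_mul, hv]
    change (τ / σ ^ 2) ^ 2 * σ ^ 2 = _
    field_simp
  have hXx : (X : ℝ) = C * (1 + q) / p := by rw [hXr, hτ2]; field_simp
  have hX0 : X ≠ 0 := by
    have : (0 : ℝ) < X := by rw [hXr]; positivity
    exact_mod_cast this.ne'
  have hw : ((n - 1 : ℕ) * X : ℝ≥0) ≠ 0 := mul_ne_zero (by norm_cast; omega) hX0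
  have key : ∀ (b : Fin n → Bool) (j : Fin n), 1 / 2 * Real.exp (-KC C) ≤
      ∫ y : Fin p → Fin n → ℝ, min (Lf (τ / σ ^ 2) (τ ^ 2 / σ ^ 2) (sv b) y)
        (Lf (τ / σ ^ 2) (τ ^ 2 / σ ^ 2) (sv (fl j b)) y) ∂(lawW p n σ) := by
    intro b j
    rw [← hXr]
    rcases le_total (p : ℝ) n with hpn | hpn
    · have h1 := aux_num1 hp1 hn1 hq hC hXx hpn
      obtain ⟨i1, i2⟩ := aux_cosh_one hw
      have := aux_key (p := p) hn hX hX0 (sv_mem b) j _ (sv_mem (fl j b)) (sv_fl j b) (sv_fl_ne j b)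
        (fun _ => 1) measurable_const (fun z => (aux_tanh_sq_le z).1) 1
        (by simpa using i1) (by simpa using i2)
      refine le_trans ?_ this
      gcongr
    · obtain ⟨i1, i2⟩ := aux_cosh_sq hw
      have h1 := aux_num2 (w := ((n - 1 : ℕ) * X : ℝ≥0)) hp1 hn1 hq hC hXx hpn NNReal.zero_le_coe (by
        rw [NNReal.coe_mul, NNReal.coe_natCast]
        gcongr
        omega)
      have := aux_key (p := p) hn hX hX0 (sv_mem b) j _ (sv_mem (fl j b)) (sv_fl j b) (sv_fl_ne j b)
        (fun z => z ^ 2) (measurable_id.pow_const 2) (fun z => (aux_tanh_sq_le z).2) _ i1 i2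
      refine le_trans ?_ this
      gcongr
  have hL : ∀ b : Fin n → Bool, Integrable
      (fun y : Fin p → Fin n → ℝ => Lf (τ / σ ^ 2) (τ ^ 2 / σ ^ 2) (sv b) y) (lawW p n σ) := by
    intro b
    rw [← hXr]
    exact (aux_L_int hn hX hX0 (sv_mem b)).1
  obtain ⟨ε, b, hεb⟩ := aux_avg hn hσ τ _ hL key (by positivity) hf hf2
  have hmem : ((fun i => τ * sv ε i, sv b) : (Fin p → ℝ) × (Fin n → ℝ)) ∈ Omega p n Δ := by
    refine ⟨?_, sv_mem b⟩
    unfold eucNorm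
    apply Real.le_sqrt_of_sq_le
    have : ∀ i, (τ * sv ε i) ^ 2 = τ ^ 2 := by
      intro i; rcases sv_mem ε i with h | h <;> rw [h] <;> ring
    simp only [this, sum_const, card_univ, Fintype.card_fin, nsmul_eq_mul]
    rw [hτ2, mul_div_cancel₀ _ (by linarith)]
    exact h
  refine hεb.trans (le_ciSup (f := fun x : Omega p n Δ => (n : ℝ)⁻¹ * risk p n σ f x.1.1 x.1.2)
    ⟨1, ?_⟩ ⟨_, hmem⟩)
  rintro _ ⟨x, rfl⟩
  exact (aux_risk_bd hf hf2 x.2.2 _ _).2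

lemma aux_part2 (p : ℕ → ℕ) (σ Δ : ℕ → ℝ)
    (hp : ∀ n, 1 ≤ p n) (hσ : ∀ n, 0 < σ n) (hΔ : ∀ n, 0 < Δ n)
    (h : (fun n => Δ n ^ 2) =O[atTop] fun n => σ n ^ 2 * (1 + Real.sqrt ((p n : ℝ) / n))) :
      0 < atTop.liminf (fun n =>
        ⨅ f : {f : (Fin (p n) → Fin n → ℝ) → Fin n → ℝ //
            Measurable f ∧ ∀ y, f y ∈ pmOne n},
          ⨆ x : Omega (p n) n (Δ n),
            (n : ℝ)⁻¹ * risk (p n) n (σ n) f.1 x.1.1 x.1.2) := by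
  obtain ⟨C, hC, hb⟩ := h.exists_pos
  rw [isBigOWith_iff] at hb
  have hpos : 0 < (1 / 2 * Real.exp (-KC (max C 1))) / 4 := by positivity
  refine lt_of_lt_of_le hpos ?_
  have ne : ∀ n, Nonempty {f : (Fin (p n) → Fin n → ℝ) → Fin n → ℝ //
            Measurable f ∧ ∀ y, f y ∈ pmOne n} :=
    fun n => ⟨⟨fun _ _ => 1, measurable_const, fun _ _ => Or.inl rfl⟩⟩
  have nn : ∀ n (f : {f : (Fin (p n) → Fin n → ℝ) → Fin n → ℝ //
            Measurable f ∧ ∀ y, f y ∈ pmOne n}), 0 ≤ ⨆ x : Omega (p n) n (Δ n),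
            (n : ℝ)⁻¹ * risk (p n) n (σ n) f.1 x.1.1 x.1.2 := fun n f =>
    Real.iSup_nonneg fun x => (aux_risk_bd f.2.1 f.2.2 x.2.2 _ _).1
  refine le_liminf_of_le ?_ ?_
  · refine IsBoundedUnder.isCoboundedUnder_ge ⟨1, ?_⟩
    rw [eventually_map]
    refine Eventually.of_forall fun n => ?_
    obtain ⟨f⟩ := ne n
    refine (ciInf_le ⟨0, ?_⟩ f).trans ?_
    · rintro _ ⟨f, rfl⟩; exact nn n f
    · exact Real.iSup_le (fun x => (aux_risk_bd f.2.1 f.2.2 x.2.2 _ _).2) zero_le_one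
  · filter_upwards [hb, eventually_ge_atTop 2] with n hn hn2
    have := ne n
    refine le_ciInf fun f => ?_
    refine aux_lower (hp n) hn2 (hσ n) (hΔ n) (le_max_right _ _) ?_ f.2.1 f.2.2
    have e0 : 0 ≤ σ n ^ 2 * (1 + √((p n : ℝ) / n)) := by positivity
    rw [Real.norm_eq_abs, Real.norm_eq_abs, abs_of_nonneg e0, abs_of_nonneg (sq_nonneg _)] at hn
    exact hn.trans (mul_le_mul_of_nonneg_right (le_max_left _ _) e0)

/-- Theorem 7: phase transition for almost full recovery. -/
theorem statement12 (p : ℕ → ℕ) (σ Δ : ℕ → ℝ)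
    (hp : ∀ n, 1 ≤ p n) (hσ : ∀ n, 0 < σ n) (hΔ : ∀ n, 0 < Δ n) :
    (((fun n => σ n ^ 2 * (1 + Real.sqrt ((p n : ℝ) / n))) =o[atTop]
        fun n => Δ n ^ 2) →
      ∃ est : (n : ℕ) → (Fin (p n) → Fin n → ℝ) → Fin n → ℝ,
        (∀ n, Measurable (est n)) ∧ (∀ n y, est n y ∈ pmOne n) ∧
        Tendsto (fun n => ⨆ x : Omega (p n) n (Δ n),
          (n : ℝ)⁻¹ * risk (p n) n (σ n) (est n) x.1.1 x.1.2) atTop (nhds 0))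
    ∧ (((fun n => Δ n ^ 2) =O[atTop]
        fun n => σ n ^ 2 * (1 + Real.sqrt ((p n : ℝ) / n))) →
      0 < atTop.liminf (fun n =>
        ⨅ f : {f : (Fin (p n) → Fin n → ℝ) → Fin n → ℝ //
            Measurable f ∧ ∀ y, f y ∈ pmOne n},
          ⨆ x : Omega (p n) n (Δ n),
            (n : ℝ)⁻¹ * risk (p n) n (σ n) f.1 x.1.1 x.1.2)) := by
  exact ⟨aux_part1 p σ Δ hp hσ hΔ, aux_part2 p σ Δ hp hσ hΔ⟩

end
end

section
/- There exist absolute constants c, C, C' > 0 such that the following holds. Let n, p ≥ 1, let σ > 0, and let W be a random p×n matrix with i.i.d. centered Gaussian entries of variance τ² for some 0 < τ ≤ σ. Then for every t ≥ C σ² · max(1, √(p/n)), P( (1/n) ‖H(WᵀW)‖_op ≥ t ) ≤ exp( −(c n t/σ²) · min(1, t n/(p σ²)) ), and moreover E[ ((1/n) ‖H(WᵀW)‖_op)² ] ≤ C' σ⁴ (1 + p/n). -/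
open MeasureTheory ProbabilityTheory Filter Finset Asymptotics
open scoped ENNReal

noncomputable section

theorem aux_exp_ineq (v : ℝ) (_h1 : -(1/2) ≤ v) (h2 : v ≤ 1/2) : 1 ≤ (1 - v) * Real.exp (v + v^2) := by
  rcases le_total v 0 with h | h
  · have := Real.add_one_le_exp (v + v^2)
    nlinarith [mul_le_mul_of_nonneg_left this (by linarith : (0:ℝ) ≤ 1 - v), pow_nonneg (neg_nonneg.2 h) 3]
  · have := Real.quadratic_le_exp_of_nonneg (x := v + v^2) (by positivity)
    have h3 := mul_le_mul_of_nonneg_left this (by linarith : (0:ℝ) ≤ 1 - v)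
    refine le_trans ?_ h3
    have : (1 - v) * (1 + (v + v ^ 2) + (v + v ^ 2) ^ 2 / 2) - 1 = v^2 * (1 - v - v^2 - v^3)/2 := by ring
    have h4 : 0 ≤ v^2 * (1 - v - v^2 - v^3)/2 := by
      have : 0 ≤ 1 - v - v^2 - v^3 := by nlinarith [mul_nonneg h h, mul_nonneg h (sub_nonneg.2 h2), mul_nonneg (mul_nonneg h h) (sub_nonneg.2 h2)]
      positivity
    linarith

theorem aux_gauss (τ s : ℝ) (hτ : 0 < τ) (hs : |s| * τ^2 ≤ 1/4) :
    Integrable (fun x : ℝ => Real.exp (s * (x^2 - τ^2))) (gaussianReal 0 (τ^2).toNNReal) ∧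
    ∫ x, Real.exp (s * (x^2 - τ^2)) ∂(gaussianReal 0 (τ^2).toNNReal) ≤ Real.exp (2 * s^2 * τ^4) := by
  have hv : (τ^2).toNNReal ≠ 0 := by
    have : 0 < (τ^2).toNNReal := Real.toNNReal_pos.2 (by positivity)
    exact this.ne'
  have hvc : ((τ^2).toNNReal : ℝ) = τ^2 := Real.coe_toNNReal _ (by positivity)
  have hsb : -(1/4) ≤ s * τ^2 ∧ s * τ^2 ≤ 1/4 := by
    rw [← abs_le, abs_mul, abs_of_nonneg (sq_nonneg τ)]; exact hs
  set b : ℝ := 1/(2*τ^2) - s with hb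
  have hb2 : 2 * τ^2 * b = 1 - 2 * (s*τ^2) := by rw [hb]; field_simp
  have hbpos : 0 < b := by
    have : 0 < 2 * τ^2 * b := by rw [hb2]; linarith [hsb.2]
    exact pos_of_mul_pos_right this (by positivity)
  have key : ∀ x : ℝ, gaussianPDFReal 0 (τ^2).toNNReal x * Real.exp (s * (x^2 - τ^2))
      = ((Real.sqrt (2 * Real.pi * τ^2))⁻¹ * Real.exp (-(s*τ^2))) * Real.exp (-b * x^2) := by
    intro x
    rw [gaussianPDFReal, hvc, mul_assoc (Real.sqrt _)⁻¹, mul_assoc (Real.sqrt _)⁻¹, ← Real.exp_add, ← Real.exp_add]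
    congr 2
    rw [hb]; field_simp; ring
  constructor
  · rw [gaussianReal_of_var_ne_zero _ hv, integrable_withDensity_iff_integrable_smul' (measurable_gaussianPDF _ _) (by simp [gaussianPDF])]
    simp only [gaussianPDF, ENNReal.toReal_ofReal (gaussianPDFReal_nonneg _ _ _), smul_eq_mul, key]
    exact (integrable_exp_neg_mul_sq hbpos).const_mul _
  · rw [integral_gaussianReal_eq_integral_smul hv]
    simp only [smul_eq_mul, key]
    rw [integral_const_mul, integral_gaussian]
    set u := s * τ^2 with hu
    have h1 : (Real.sqrt (2 * Real.pi * τ^2))⁻¹ * Real.exp (-u) * Real.sqrt (Real.pi / b) = 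
      Real.exp (-u) * Real.sqrt (1 / (1 - 2*u)) := by
      rw [← Real.sqrt_inv, mul_comm (Real.sqrt _), mul_assoc, ← Real.sqrt_mul (by positivity), ← hb2]
      congr 2
      field_simp
    rw [h1]
    have h2 := aux_exp_ineq (2*u) (by linarith [hsb.1]) (by linarith [hsb.2])
    have h3 : 0 < 1 - 2*u := by linarith [hsb.2]
    have h4 : Real.sqrt (1 / (1 - 2*u)) ≤ Real.exp (u + 2*u^2) := by
      apply Real.sqrt_le_iff.2 ⟨by positivity, ?_⟩
      rw [div_le_iff₀ h3, ← Real.exp_nat_mul, mul_comm]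
      have h5 : ((2:ℕ):ℝ) * (u + 2*u^2) = 2*u + (2*u)^2 := by push_cast; ring
      rw [h5]; exact h2
    calc _ ≤ Real.exp (-u) * Real.exp (u + 2*u^2) := by gcongr
      _ = Real.exp (2 * s^2 * τ^4) := by rw [← Real.exp_add]; congr 1; rw [hu]; ring

theorem aux_lin (n : ℕ) (τ : ℝ) (x : Fin n → ℝ) (hx : ∑ a, x a ^2 = 1) :
    (Measure.pi fun _ : Fin n => gaussianReal 0 (τ^2).toNNReal).map (fun g => ∑ a, x a * g a) =
      gaussianReal 0 (τ^2).toNNReal := by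
  have hm : Measurable (fun g : Fin n → ℝ => ∑ a, x a * g a) := by fun_prop
  have := Measure.isProbabilityMeasure_map (μ := Measure.pi fun _ : Fin n => gaussianReal 0 (τ^2).toNNReal) hm.aemeasurable
  apply Measure.ext_of_charFun
  ext t
  rw [charFun_apply_real, integral_map hm.aemeasurable (by fun_prop)]
  have : ∀ g : Fin n → ℝ, Complex.exp (t * ((∑ a, x a * g a : ℝ) : ℂ) * Complex.I) =
     ∏ a, Complex.exp (((t * x a : ℝ) : ℂ) * (g a : ℂ) * Complex.I) := by
    intro g
    rw [← Complex.exp_sum]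
    congr 1
    push_cast
    rw [Finset.mul_sum, Finset.sum_mul]
    congr 1; ext a; ring
  simp_rw [this]
  rw [integral_fintype_prod_eq_prod (f := fun a (y : ℝ) => Complex.exp (((t * x a : ℝ) : ℂ) * (y : ℂ) * Complex.I))]
  simp_rw [← charFun_apply_real, charFun_gaussianReal]
  rw [← Complex.exp_sum]
  congr 1
  have h2 : (∑ a, (x a : ℂ)^2) = 1 := by exact_mod_cast hx
  simp only [Complex.ofReal_zero, mul_zero, zero_mul, zero_sub, Complex.ofReal_mul]
  rw [Finset.sum_neg_distrib, ← Finset.sum_div]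
  congr 2
  rw [← mul_one (_ * (t:ℂ)^2), ← h2, Finset.mul_sum]
  congr 1; ext a; ring

theorem aux_card (n : ℕ) (s : Finset (EuclideanSpace ℝ (Fin n)))
    (hs : ∀ c ∈ s, ‖c‖ = 1) (h : ∀ c ∈ s, ∀ d ∈ s, c ≠ d → 1/4 ≤ ‖c - d‖) : s.card ≤ 9 ^ n := by
  classical
  let μ : Measure (EuclideanSpace ℝ (Fin n)) := volume
  have D : Set.Pairwise (s : Set (EuclideanSpace ℝ (Fin n))) (Function.onFun Disjoint fun c => Metric.ball c (1/8 : ℝ)) := by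
    rintro c hc d hd hcd
    apply Metric.ball_disjoint_ball
    rw [dist_eq_norm]
    convert h c hc d hd hcd
    norm_num
  have A_subset : (⋃ c ∈ s, Metric.ball c (1/8 : ℝ)) ⊆ Metric.ball (0 : EuclideanSpace ℝ (Fin n)) (9/8) := by
    refine Set.iUnion₂_subset fun x hx => ?_
    apply Metric.ball_subset_ball'
    rw [dist_zero_right, hs x hx]; norm_num
  have I : (s.card : ℝ≥0∞) * ENNReal.ofReal ((1/8) ^ n) * μ (Metric.ball 0 1) ≤
      ENNReal.ofReal ((9/8) ^ n) * μ (Metric.ball 0 1) := by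
    calc _ = μ (⋃ c ∈ s, Metric.ball c (1/8 : ℝ)) := by
          rw [measure_biUnion_finset D fun c _ => measurableSet_ball]
          simp only [μ.addHaar_ball_of_pos _ (by norm_num : (0:ℝ) < 1/8), finrank_euclideanSpace, Fintype.card_fin]
          simp only [Finset.sum_const, nsmul_eq_mul, mul_assoc]
      _ ≤ μ (Metric.ball 0 (9/8)) := measure_mono A_subset
      _ = _ := by
          simp only [μ.addHaar_ball_of_pos _ (by norm_num : (0:ℝ) < 9/8), finrank_euclideanSpace, Fintype.card_fin]
  have J : (s.card : ℝ≥0∞) * ENNReal.ofReal ((1/8) ^ n) ≤ ENNReal.ofReal ((9/8) ^ n) :=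
    (ENNReal.mul_le_mul_iff_left (Metric.measure_ball_pos _ _ zero_lt_one).ne' measure_ball_lt_top.ne).1 I
  have K := ENNReal.toReal_le_of_le_ofReal (by positivity) J
  rw [ENNReal.toReal_mul, ENNReal.toReal_ofReal (by positivity), ENNReal.toReal_natCast, div_pow, div_pow, one_pow,
    mul_one_div, div_le_div_iff_of_pos_right (by positivity)] at K
  exact_mod_cast K

theorem aux_net (n : ℕ) : ∃ s : Finset (EuclideanSpace ℝ (Fin n)), s.card ≤ 9 ^ n ∧ (∀ c ∈ s, ‖c‖ = 1) ∧
    ∀ x : EuclideanSpace ℝ (Fin n), ‖x‖ = 1 → ∃ c ∈ s, ‖x - c‖ ≤ 1/4 := by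
  classical
  let P : ℕ → Prop := fun k => ∃ s : Finset (EuclideanSpace ℝ (Fin n)), s.card = k ∧ (∀ c ∈ s, ‖c‖ = 1) ∧
    (∀ c ∈ s, ∀ d ∈ s, c ≠ d → 1/4 ≤ ‖c - d‖)
  have hP0 : P 0 := ⟨∅, by simp⟩
  obtain ⟨s, h1, h2, h3⟩ := Nat.findGreatest_spec (P := P) (Nat.zero_le (9^n)) hP0
  refine ⟨s, aux_card n s h2 h3, h2, fun x hx => ?_⟩
  by_contra! hc
  have hxs : x ∉ s := fun hxs => by have := hc x hxs; simp at this; linarith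
  have hP : P (insert x s).card := by
    refine ⟨_, rfl, ?_, ?_⟩
    · intro c hc; rcases Finset.mem_insert.1 hc with rfl | h
      · exact hx
      · exact h2 c h
    · intro c hcc d hd hcd
      rcases Finset.mem_insert.1 hcc with rfl | h <;> rcases Finset.mem_insert.1 hd with rfl | h'
      · exact absurd rfl hcd
      · exact (hc d h').le
      · rw [norm_sub_rev]; exact (hc c h).le
      · exact h3 c h d h' hcd
  have hle : (insert x s).card ≤ 9^n := by
    obtain ⟨s', a, b, c⟩ := hP
    rw [← a]; exact aux_card n s' b c
  have := Nat.le_findGreatest hle hP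
  rw [← h1, Finset.card_insert_of_notMem hxs] at this
  omega

theorem aux_sym {E : Type*} [NormedAddCommGroup E] [InnerProductSpace ℝ E] (T : E →L[ℝ] E)
    (hT : ∀ x y, inner ℝ (T x) y = inner ℝ x (T y)) (M : ℝ) (hM : 0 ≤ M)
    (h : ∀ x, ‖x‖ = 1 → |inner ℝ (T x) x| ≤ M) : ‖T‖ ≤ M := by
  have h' : ∀ x, |inner ℝ (T x) x| ≤ M * ‖x‖^2 := by
    intro x
    by_cases hx : x = 0
    · simp [hx]
    have hn : ‖x‖ ≠ 0 := norm_ne_zero_iff.2 hx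
    have := h (‖x‖⁻¹ • x) (by rw [norm_smul, norm_inv, norm_norm, inv_mul_cancel₀ hn])
    rw [map_smul, real_inner_smul_left, real_inner_smul_right, abs_mul, abs_mul, abs_inv, abs_norm] at this
    have hp : 0 < ‖x‖ := norm_pos_iff.2 hx
    field_simp at this
    rw [mul_comm]; exact this
  apply ContinuousLinearMap.opNorm_le_bound _ hM
  intro x
  by_cases hx : x = 0
  · simp [hx]
  by_cases hTx : T x = 0
  · simp [hTx]; positivity
  have hp : 0 < ‖x‖ := norm_pos_iff.2 hx
  have hq : 0 < ‖T x‖ := norm_pos_iff.2 hTx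
  set y : E := (‖x‖ / ‖T x‖) • T x with hy
  have hyn : ‖y‖ = ‖x‖ := by
    rw [hy, norm_smul, Real.norm_of_nonneg (by positivity)]; field_simp
  have e1 : 4 * inner ℝ (T x) y = inner ℝ (T (x+y)) (x+y) - inner ℝ (T (x-y)) (x-y) := by
    simp only [map_add, map_sub, inner_add_left, inner_add_right, inner_sub_left, inner_sub_right]
    rw [hT y x, real_inner_comm (T x) y]; ring
  have e2 : inner ℝ (T x) y = ‖x‖ * ‖T x‖ := by
    rw [hy, real_inner_smul_right, real_inner_self_eq_norm_sq]; field_simp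
  have e3 := abs_le.1 (h' (x+y))
  have e4 := abs_le.1 (h' (x-y))
  have e5 := parallelogram_law_with_norm ℝ x y
  rw [hyn] at e5
  have : ‖x‖ * ‖T x‖ ≤ ‖x‖ * (M * ‖x‖) := by
    have : M * ‖x+y‖^2 + M * ‖x-y‖^2 = M * (4 * ‖x‖^2) := by rw [← mul_add]; congr 1; nlinarith
    nlinarith
  exact le_of_mul_le_mul_left this hp

theorem aux_sym_net {E : Type*} [NormedAddCommGroup E] [InnerProductSpace ℝ E] (T : E →L[ℝ] E)
    (hT : ∀ x y, inner ℝ (T x) y = inner ℝ x (T y)) (s : Finset E) (hs : ∀ c ∈ s, ‖c‖ = 1)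
    (hs' : ∀ x : E, ‖x‖ = 1 → ∃ c ∈ s, ‖x - c‖ ≤ 1/4)
    (M : ℝ) (hM : 0 ≤ M) (h : ∀ x ∈ s, |inner ℝ (T x) x| ≤ M) : ‖T‖ ≤ 2 * M := by
  have : ‖T‖ ≤ M + ‖T‖/2 := by
    apply aux_sym T hT _ (by positivity)
    intro x hx
    obtain ⟨c, hc, hxc⟩ := hs' x hx
    have e : inner ℝ (T x) x = inner ℝ (T c) c + (inner ℝ (T (x - c)) x + inner ℝ (T c) (x - c)) := by
      simp only [map_sub, inner_sub_left, inner_sub_right]; ring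
    have b1 : |inner ℝ (T (x - c)) x| ≤ ‖T‖ * (1/4) := by
      refine (abs_real_inner_le_norm _ _).trans ?_
      rw [hx, mul_one]
      exact (T.le_opNorm _).trans (by gcongr)
    have b2 : |inner ℝ (T c) (x - c)| ≤ ‖T‖ * (1/4) := by
      refine (abs_real_inner_le_norm _ _).trans ?_
      have := T.le_opNorm c
      rw [hs c hc, mul_one] at this
      gcongr
    rw [e]
    have := h c hc
    refine (abs_add_le _ _).trans ?_
    have := abs_add_le (inner ℝ (T (x - c)) x) (inner ℝ (T c) (x - c))
    linarith
  linarith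

def qrow {n : ℕ} (x g : Fin n → ℝ) : ℝ := (∑ a, x a * g a)^2 - ∑ a, x a^2 * g a^2

theorem aux_row_s17 (n : ℕ) (τ l : ℝ) (hτ : 0 < τ) (hl : |l| * τ^2 ≤ 1/8) (x : Fin n → ℝ) (hx : ∑ a, x a ^2 = 1) :
    Integrable (fun g : Fin n → ℝ => Real.exp (l * qrow x g))
      (Measure.pi fun _ : Fin n => gaussianReal 0 (τ^2).toNNReal) ∧
    ∫ g, Real.exp (l * qrow x g) ∂(Measure.pi fun _ : Fin n => gaussianReal 0 (τ^2).toNNReal)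
      ≤ Real.exp (8 * l^2 * τ^4) := by
  set μ := (Measure.pi fun _ : Fin n => gaussianReal 0 (τ^2).toNNReal) with hμ
  obtain ⟨i1, b1⟩ := aux_gauss τ (2*l) hτ (by rw [abs_mul, abs_two]; linarith)
  obtain ⟨i2, b2⟩ := aux_gauss τ (-(2*l)) hτ (by rw [abs_neg, abs_mul, abs_two]; linarith)
  have hm : Measurable (fun g : Fin n → ℝ => ∑ a, x a * g a) := by fun_prop
  have hlaw := aux_lin n τ x hx
  have I1 : Integrable (fun g : Fin n → ℝ => Real.exp (2*l * ((∑ a, x a * g a)^2 - τ^2))) μ := by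
    rw [← hlaw] at i1
    exact i1.comp_measurable hm
  have B1 : ∫ g, Real.exp (2*l * ((∑ a, x a * g a)^2 - τ^2)) ∂μ ≤ Real.exp (8 * l^2 * τ^4) := by
    rw [← hlaw, integral_map hm.aemeasurable (by fun_prop)] at b1
    refine b1.trans (le_of_eq ?_)
    congr 1; ring
  have hmp : ∀ a, MeasurePreserving (Function.eval a) μ (gaussianReal 0 (τ^2).toNNReal) := fun a =>
    measurePreserving_eval (fun _ : Fin n => gaussianReal 0 (τ^2).toNNReal) a
  have I2 : ∀ a, Integrable (fun g : Fin n → ℝ => Real.exp (-(2*l) * (g a^2 - τ^2))) μ := fun a =>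
    (hmp a).integrable_comp_of_integrable i2
  have B2 : ∀ a, ∫ g, Real.exp (-(2*l) * (g a^2 - τ^2)) ∂μ ≤ Real.exp (8 * l^2 * τ^4) := by
    intro a
    rw [← (hmp a).map_eq, integral_map (hmp a).measurable.aemeasurable (by fun_prop)] at b2
    refine b2.trans (le_of_eq ?_)
    congr 1; ring
  set G : (Fin n → ℝ) → ℝ := fun g => (1/2) * Real.exp (2*l * ((∑ a, x a * g a)^2 - τ^2)) +
    (1/2) * ∑ a, x a^2 * Real.exp (-(2*l) * (g a^2 - τ^2)) with hG
  have IS : Integrable (fun g : Fin n → ℝ => ∑ a, x a^2 * Real.exp (-(2*l) * (g a^2 - τ^2))) μ :=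
    integrable_finsetSum _ fun a _ => (I2 a).const_mul _
  have IG : Integrable G μ := (I1.const_mul _).add (IS.const_mul _)
  have hle : ∀ g, Real.exp (l * qrow x g) ≤ G g := by
    intro g
    set A := Real.exp (l * ((∑ a, x a * g a)^2 - τ^2))
    set B := Real.exp (∑ a, x a^2 * (-l * (g a^2 - τ^2)))
    have e1 : Real.exp (l * qrow x g) = A * B := by
      rw [← Real.exp_add]; congr 1
      have : ∑ a, x a^2 * (-l * (g a^2 - τ^2)) = -l * (∑ a, x a^2 * g a^2) + l * τ^2 * ∑ a, x a^2 := by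
        rw [Finset.mul_sum, Finset.mul_sum, ← Finset.sum_add_distrib]
        congr 1; ext a; ring
      rw [this, hx, qrow]; ring
    have e2 : A^2 = Real.exp (2*l * ((∑ a, x a * g a)^2 - τ^2)) := by
      rw [← Real.exp_nat_mul]; congr 1; push_cast; ring
    have e3 : B^2 ≤ ∑ a, x a^2 * Real.exp (-(2*l) * (g a^2 - τ^2)) := by
      rw [← Real.exp_nat_mul]
      have := convexOn_exp.map_sum_le (t := Finset.univ) (w := fun a => x a^2)
        (p := fun a => -(2*l) * (g a^2 - τ^2)) (fun a _ => sq_nonneg _) hx (fun a _ => Set.mem_univ _)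
      simp only [smul_eq_mul] at this
      refine le_trans (le_of_eq ?_) this
      congr 1
      rw [Finset.mul_sum]; congr 1; ext a; push_cast; ring
    rw [e1, hG]
    simp only
    rw [← e2]
    nlinarith [sq_nonneg (A - B)]
  have hI : Integrable (fun g : Fin n → ℝ => Real.exp (l * qrow x g)) μ := by
    refine IG.mono' ?_ (Eventually.of_forall fun g => ?_)
    · unfold qrow; fun_prop
    · rw [Real.norm_of_nonneg (Real.exp_pos _).le]; exact hle g
  refine ⟨hI, (integral_mono hI IG hle).trans ?_⟩
  rw [hG, integral_add (I1.const_mul _) (IS.const_mul _), integral_const_mul, integral_const_mul,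
    integral_finsetSum _ fun a _ => (I2 a).const_mul _]
  simp only [integral_const_mul]
  have : ∑ a, x a^2 * ∫ g, Real.exp (-(2*l) * (g a^2 - τ^2)) ∂μ ≤ ∑ a, x a^2 * Real.exp (8 * l^2 * τ^4) :=
    Finset.sum_le_sum fun a _ => mul_le_mul_of_nonneg_left (B2 a) (sq_nonneg _)
  rw [← Finset.sum_mul, hx, one_mul] at this
  linarith

theorem aux_rows (p n : ℕ) (τ l : ℝ) (hτ : 0 < τ) (hl : |l| * τ^2 ≤ 1/8) (x : Fin n → ℝ) (hx : ∑ a, x a ^2 = 1) :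
    Integrable (fun w : Fin p → Fin n → ℝ => Real.exp (l * ∑ i, qrow x (w i))) (lawW p n τ) ∧
    ∫ w, Real.exp (l * ∑ i, qrow x (w i)) ∂(lawW p n τ) ≤ Real.exp (8 * p * l^2 * τ^4) := by
  obtain ⟨h1, h2⟩ := aux_row_s17 n τ l hτ hl x hx
  have e : ∀ w : Fin p → Fin n → ℝ, Real.exp (l * ∑ i, qrow x (w i)) = ∏ i, Real.exp (l * qrow x (w i)) := by
    intro w; rw [Finset.mul_sum, Real.exp_sum]
  simp only [e]
  constructor
  · exact Integrable.fintype_prod (f := fun _ g => Real.exp (l * qrow x g)) fun _ => h1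
  · rw [lawW, integral_fintype_prod_eq_prod (f := fun _ g => Real.exp (l * qrow x g))]
    rw [Finset.prod_const, Finset.card_univ, Fintype.card_fin]
    calc _ ≤ (Real.exp (8 * l^2 * τ^4))^p := by
          gcongr
      _ = _ := by rw [← Real.exp_nat_mul]; congr 1; ring

theorem aux_inner {n : ℕ} (M : Matrix (Fin n) (Fin n) ℝ) (x y : EuclideanSpace ℝ (Fin n)) :
    inner ℝ (LinearMap.toContinuousLinearMap (Matrix.toEuclideanLin M) x) y = ∑ a, ∑ b, M a b * x b * y a := by
  simp [PiLp.inner_apply, Matrix.toLpLin_apply, Matrix.mulVec, dotProduct, Finset.mul_sum]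
  refine Finset.sum_congr rfl fun a _ => Finset.sum_congr rfl fun b _ => by ring

theorem aux_quad {p n : ℕ} (w : Fin p → Fin n → ℝ) (x : EuclideanSpace ℝ (Fin n)) :
    inner ℝ (LinearMap.toContinuousLinearMap (Matrix.toEuclideanLin (hollow (gramMat w))) x) x =
      ∑ i, qrow x (w i) := by
  rw [aux_inner]
  have : ∀ a b, hollow (gramMat w) a b * x b * x a =
     ∑ i, (x a * w i a) * (x b * w i b) - if a = b then ∑ i, (x a * w i a)* (x a * w i a) else 0 := by
    intro a b
    simp only [hollow, gramMat, Matrix.of_apply]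
    split_ifs with h
    · subst h; simp
    · rw [sub_zero, Finset.sum_mul, Finset.sum_mul]; congr 1; ext i; ring
  simp only [this, Finset.sum_sub_distrib, Finset.sum_ite_eq, Finset.mem_univ, if_true, qrow]
  congr 1
  · rw [Finset.sum_congr rfl fun a _ => Finset.sum_comm, Finset.sum_comm]
    refine Finset.sum_congr rfl fun i _ => ?_
    rw [sq, Finset.sum_mul_sum]
  · rw [Finset.sum_comm]
    refine Finset.sum_congr rfl fun i _ => Finset.sum_congr rfl fun a _ => by ring

theorem aux_hsym {p n : ℕ} (w : Fin p → Fin n → ℝ) (x y : EuclideanSpace ℝ (Fin n)) :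
    inner ℝ (LinearMap.toContinuousLinearMap (Matrix.toEuclideanLin (hollow (gramMat w))) x) y =
    inner ℝ x (LinearMap.toContinuousLinearMap (Matrix.toEuclideanLin (hollow (gramMat w))) y) := by
  rw [real_inner_comm _ x, aux_inner, aux_inner, Finset.sum_comm]
  refine Finset.sum_congr rfl fun a _ => Finset.sum_congr rfl fun b _ => ?_
  have : hollow (gramMat w) b a = hollow (gramMat w) a b := by
    simp only [hollow, gramMat, Matrix.of_apply, eq_comm (a := a)]
    split_ifs
    · rfl
    · refine Finset.sum_congr rfl fun i _ => by ring
  rw [this]; ring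

theorem aux_key_s17 (p n : ℕ) (hn : 1 ≤ n) (σ τ l : ℝ) (hτ : 0 < τ) (hτσ : τ ≤ σ) (hl0 : 0 ≤ l) (hl : l * σ^2 ≤ 1/16) :
    ∃ F : (Fin p → Fin n → ℝ) → ℝ, Integrable F (lawW p n τ) ∧
      (∀ w, Real.exp (l * opNorm (hollow (gramMat w))) ≤ F w) ∧
      ∫ w, F w ∂(lawW p n τ) ≤ 2 * 9^n * Real.exp (32 * p * l^2 * σ^4) := by
  obtain ⟨s, hc, h1, h2⟩ := aux_net n
  have hx : ∀ c ∈ s, ∑ a, c a ^2 = 1 := by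
    intro c hcs
    have := EuclideanSpace.real_norm_sq_eq c
    rw [h1 c hcs] at this
    linarith
  have hlt : 2 * l * τ^2 ≤ 1/8 := by
    have : l * τ^2 ≤ l * σ^2 := by gcongr
    linarith
  have R1 : ∀ c ∈ s, _ := fun c hcs => aux_rows p n τ (2*l) hτ (by rwa [abs_of_nonneg (by positivity)]) c (hx c hcs)
  have R2 : ∀ c ∈ s, _ := fun c hcs => aux_rows p n τ (-(2*l)) hτ (by rwa [abs_neg, abs_of_nonneg (by positivity)]) c (hx c hcs)
  have hb : Real.exp (8 * p * (2*l)^2 * τ^4) ≤ Real.exp (32 * p * l^2 * σ^4) := by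
    apply Real.exp_le_exp.2
    have : 8 * p * (2*l)^2 * τ^4 = 32 * p * l^2 * τ^4 := by ring
    rw [this]; gcongr
  have hI : ∀ c ∈ s, Integrable (fun w : Fin p → Fin n → ℝ => Real.exp (2*l * ∑ i, qrow c (w i)) +
    Real.exp (-(2*l) * ∑ i, qrow c (w i))) (lawW p n τ) := fun c hcs => (R1 c hcs).1.add (R2 c hcs).1
  refine ⟨fun w => ∑ c ∈ s, (Real.exp (2*l * ∑ i, qrow c (w i)) + Real.exp (-(2*l) * ∑ i, qrow c (w i))),
    integrable_finsetSum _ hI, ?_, ?_⟩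
  · intro w
    have : Nonempty (Fin n) := ⟨⟨0, hn⟩⟩
    have hsne : s.Nonempty := by
      obtain ⟨c, hcs, _⟩ := h2 (EuclideanSpace.single ⟨0, hn⟩ 1) (by simp)
      exact ⟨c, hcs⟩
    obtain ⟨c, hcs, hmax⟩ := s.exists_max_image (fun c => |∑ i, qrow c (w i)|) hsne
    have hop : opNorm (hollow (gramMat w)) ≤ 2 * |∑ i, qrow c (w i)| := by
      apply aux_sym_net _ (aux_hsym w) s h1 h2 _ (abs_nonneg _)
      intro x hxs
      rw [aux_quad]; exact hmax x hxs
    refine le_trans ?_ (Finset.single_le_sum (f := fun c : EuclideanSpace ℝ (Fin n) => Real.exp (2*l * ∑ i, qrow c (w i)) + Real.exp (-(2*l) * ∑ i, qrow c (w i)))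
      (fun c _ => by positivity) hcs)
    simp only
    have hA : Real.exp (l * opNorm (hollow (gramMat w))) ≤ Real.exp (2 * l * |∑ i, qrow c (w i)|) := by
      apply Real.exp_le_exp.2
      nlinarith
    refine hA.trans ?_
    rcases abs_choice (∑ i, qrow c (w i)) with h | h <;> rw [h]
    · linarith [Real.exp_pos (-(2*l) * ∑ i, qrow c (w i))]
    · rw [mul_neg, ← neg_mul]; linarith [Real.exp_pos ((2*l) * ∑ i, qrow c (w i))]
  · rw [integral_finsetSum _ hI]
    calc _ ≤ ∑ c ∈ s, 2 * Real.exp (32 * p * l^2 * σ^4) := by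
          refine Finset.sum_le_sum fun c hcs => ?_
          rw [integral_add (R1 c hcs).1 (R2 c hcs).1]
          have a1 := (R1 c hcs).2
          have a2 := (R2 c hcs).2
          rw [neg_sq] at a2
          linarith
      _ = s.card * (2 * Real.exp (32 * p * l^2 * σ^4)) := by rw [Finset.sum_const, nsmul_eq_mul]
      _ ≤ (9:ℝ)^n * (2 * Real.exp (32 * p * l^2 * σ^4)) := by
          gcongr; exact_mod_cast hc
      _ = _ := by ring

theorem aux_pow (n : ℕ) (hn : 1 ≤ n) : (2:ℝ) * 9^n ≤ Real.exp (3 * n) := by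
  have h1 : (18:ℝ) ≤ Real.exp 3 := by
    have := Real.exp_one_gt_d9
    have h : Real.exp 3 = (Real.exp 1)^3 := by rw [← Real.exp_nat_mul]; norm_num
    rw [h]
    calc (18:ℝ) ≤ 2.7^3 := by norm_num
      _ ≤ _ := by gcongr; linarith
  calc (2:ℝ) * 9^n ≤ 2^n * 9^n := by
        gcongr; exact le_self_pow₀ (by norm_num) (by omega)
    _ = 18^n := by rw [← mul_pow]; norm_num
    _ ≤ (Real.exp 3)^n := by gcongr
    _ = _ := by rw [← Real.exp_nat_mul]; congr 1; ring

instance aux_prob (p n : ℕ) (τ : ℝ) : IsProbabilityMeasure (lawW p n τ) := by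
  unfold lawW; infer_instance

theorem aux_tail (n p : ℕ) (σ τ : ℝ) (hn : 1 ≤ n) (hp : 1 ≤ p) (hτ : 0 < τ) (hτσ : τ ≤ σ) (t : ℝ)
    (ht : 768 * σ ^ 2 * max 1 (Real.sqrt ((p : ℝ) / n)) ≤ t) :
    ((lawW p n τ) {w | t ≤ opNorm (hollow (gramMat w)) / n}).toReal
            ≤ Real.exp (-(1/256 * n * t / σ ^ 2) * min 1 (t * n / ((p : ℝ) * σ ^ 2))) := by
  have hσ : 0 < σ := hτ.trans_le hτσ
  have hn' : (1:ℝ) ≤ n := by exact_mod_cast hn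
  have hp' : (1:ℝ) ≤ p := by exact_mod_cast hp
  set D := max 1 (Real.sqrt ((p : ℝ) / n)) with hD
  have hD1 : 1 ≤ D := le_max_left _ _
  have hD2 : (p:ℝ) ≤ n * D^2 := by
    have h1 : Real.sqrt ((p : ℝ) / n) ≤ D := le_max_right _ _
    have := Real.sqrt_le_iff.1 h1
    rw [div_le_iff₀ (by positivity)] at this
    linarith [this.2]
  obtain ⟨r, hr⟩ : ∃ r, t = r * σ^2 := ⟨t/σ^2, by field_simp⟩
  have hrD : 768 * D ≤ r := by
    rw [hr] at ht
    have : (768 * D) * σ^2 ≤ r * σ^2 := by linarith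
    exact le_of_mul_le_mul_right this (by positivity)
  have hr0 : 768 ≤ r := by linarith
  have e1 : t * n / ((p : ℝ) * σ ^ 2) = r * n / p := by rw [hr]; field_simp
  rw [e1]
  set m := min 1 (r * n / p) with hm
  have hm0 : 0 < m := lt_min one_pos (by positivity)
  have hm1 : m ≤ 1 := min_le_left _ _
  have hm2 : p * m ≤ r * n := by
    have : m ≤ r * n / p := min_le_right _ _
    rw [le_div_iff₀ (by positivity)] at this; linarith
  have hrm : 768 ≤ r * m := by
    rcases min_choice 1 (r * n / p) with h | h
    · rw [hm, h]; linarith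
    · rw [hm, h, ← mul_div_assoc, le_div_iff₀ (by positivity)]
      have : 768 * D * (768 * D) ≤ r * r := by gcongr
      have : 768 * D * (768 * D) * n ≤ r * r * n := by gcongr
      nlinarith
  obtain ⟨F, hF1, hF2, hF3⟩ := aux_key_s17 p n hn σ τ (m / (64 * σ^2)) hτ hτσ (by positivity) (by
    have : m / (64 * σ^2) * σ^2 = m / 64 := by field_simp
    rw [this]; linarith)
  have hsub : {w : Fin p → Fin n → ℝ | t ≤ opNorm (hollow (gramMat w)) / n} ⊆ {w | Real.exp (n * r * m / 64) ≤ F w} := by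
    intro w hw
    simp only [Set.mem_ofPred_eq] at hw ⊢
    refine le_trans (Real.exp_le_exp.2 ?_) (hF2 w)
    rw [le_div_iff₀ (by positivity), hr] at hw
    have : n * r * m / 64 = m / (64*σ^2) * (r * σ^2 * n) := by field_simp
    rw [this]; gcongr
  have hM := mul_meas_ge_le_integral_of_nonneg (Eventually.of_forall fun w => (Real.exp_pos _).le.trans (hF2 w)) hF1
    (Real.exp (n * r * m / 64))
  have hS : ((lawW p n τ) {w | t ≤ opNorm (hollow (gramMat w)) / n}).toReal ≤
      (lawW p n τ).real {w | Real.exp (n * r * m / 64) ≤ F w} := measureReal_mono hsub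
  refine hS.trans ?_
  have h32 : 32 * p * (m / (64 * σ^2))^2 * σ^4 ≤ n * r * m / 128 := by
    have : 32 * p * (m / (64 * σ^2))^2 * σ^4 = (p * m) * m / 128 := by field_simp; norm_num
    rw [this]
    have : (p * m) * m ≤ (r * n) * m := by gcongr
    linarith
  have h3n : 3 * n + n * r * m / 128 ≤ n * r * m / 64 - n * r * m / 256 := by
    have : n * 768 ≤ n * (r * m) := by gcongr
    linarith
  have hfin : ∫ w, F w ∂(lawW p n τ) ≤ Real.exp (n * r * m / 64) * Real.exp (-(n * r * m / 256)) := by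
    refine hF3.trans ?_
    calc _ ≤ Real.exp (3 * n) * Real.exp (n * r * m / 128) := by
          gcongr; exact aux_pow n hn
      _ = Real.exp (3 * n + n * r * m / 128) := by rw [Real.exp_add]
      _ ≤ Real.exp (n * r * m / 64 + -(n * r * m / 256)) := Real.exp_le_exp.2 (by linarith)
      _ = _ := Real.exp_add _ _
  have := le_of_mul_le_mul_left (hM.trans hfin) (Real.exp_pos _)
  refine this.trans (le_of_eq ?_)
  congr 1; rw [hr]; field_simp

theorem aux_moment (n p : ℕ) (σ τ : ℝ) (hn : 1 ≤ n) (_hp : 1 ≤ p) (hτ : 0 < τ) (hτσ : τ ≤ σ) :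
    (∫ w, (opNorm (hollow (gramMat w)) / n) ^ 2 ∂(lawW p n τ))
          ≤ 147456 * σ ^ 4 * (1 + (p : ℝ) / n) := by
  have hσ : 0 < σ := hτ.trans_le hτσ
  have hn' : (1:ℝ) ≤ n := by exact_mod_cast hn
  set D := max 1 (Real.sqrt ((p : ℝ) / n)) with hD
  have hD1 : 1 ≤ D := le_max_left _ _
  have hD2 : (p:ℝ) ≤ n * D^2 := by
    have h1 : Real.sqrt ((p : ℝ) / n) ≤ D := le_max_right _ _
    have := Real.sqrt_le_iff.1 h1
    rw [div_le_iff₀ (by positivity)] at this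
    linarith [this.2]
  have hD3 : D^2 ≤ 1 + (p:ℝ)/n := by
    have h0 : 0 ≤ (p:ℝ)/n := by positivity
    rcases max_choice 1 (Real.sqrt ((p : ℝ) / n)) with h | h
    · rw [hD, h]; linarith
    · rw [hD, h, Real.sq_sqrt h0]; linarith
  set l := 1 / (64 * σ^2 * D) with hl
  have hl0 : 0 < l := by positivity
  obtain ⟨F, hF1, hF2, hF3⟩ := aux_key_s17 p n hn σ τ l hτ hτσ hl0.le (by
    have : l * σ^2 = 1 / (64 * D) := by rw [hl]; field_simp
    rw [this]
    apply one_div_le_one_div_of_le <;> linarith)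
  have h32 : 32 * p * l^2 * σ^4 ≤ n := by
    have : 32 * p * l^2 * σ^4 = p / (128 * D^2) := by rw [hl]; field_simp; norm_num
    rw [this, div_le_iff₀ (by positivity)]
    nlinarith [show (0:ℝ) ≤ n * D^2 by positivity]
  have hFint : ∫ w, F w ∂(lawW p n τ) ≤ Real.exp (4 * n) := by
    refine hF3.trans ?_
    calc _ ≤ Real.exp (3 * n) * Real.exp n := by
          gcongr; exact aux_pow n hn
      _ = Real.exp (4 * n) := by rw [← Real.exp_add]; congr 1; ring
  have hpt : ∀ w : Fin p → Fin n → ℝ, (opNorm (hollow (gramMat w)) / n) ^ 2 ≤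
      (1 / (l * n))^2 * (32 * n^2 + 4 * (Real.exp (-(4 * n)) * F w)) := by
    intro w
    set N := opNorm (hollow (gramMat w)) with hN
    have hN0 : 0 ≤ N := norm_nonneg _
    have e : (N / n)^2 = (1/(l*n))^2 * (l*N)^2 := by field_simp
    rw [e]
    have h1 : Real.exp (l * N - 4 * n) ≤ Real.exp (-(4*n)) * F w := by
      rw [sub_eq_add_neg, Real.exp_add, mul_comm]
      gcongr; exact hF2 w
    have h2 : (l*N)^2 ≤ 32 * n^2 + 4 * Real.exp (l * N - 4 * n) := by
      have hv : 0 ≤ l * N := by positivity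
      rcases le_total (l*N) (4*n) with h | h
      · have : (l*N)^2 ≤ (4*n)^2 := by gcongr
        nlinarith [Real.exp_pos (l * N - 4 * n)]
      · have := Real.quadratic_le_exp_of_nonneg (sub_nonneg.2 h)
        nlinarith [sq_nonneg (l*N - 8*n)]
    gcongr
    linarith
  have hI : Integrable (fun w => (1 / (l * n))^2 * (32 * n^2 + 4 * (Real.exp (-(4 * n)) * F w))) (lawW p n τ) :=
    ((integrable_const _).add ((hF1.const_mul _).const_mul _)).const_mul _
  refine (integral_mono_of_nonneg (Eventually.of_forall fun w => sq_nonneg _) hI (Eventually.of_forall hpt)).trans ?_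
  rw [integral_const_mul, integral_add (integrable_const _) ((hF1.const_mul _).const_mul _), integral_const_mul,
    integral_const_mul, integral_const]
  simp only [probReal_univ, one_smul]
  have hle1 : Real.exp (-(4 * n)) * ∫ w, F w ∂(lawW p n τ) ≤ 1 := by
    calc _ ≤ Real.exp (-(4 * n)) * Real.exp (4 * n) := by gcongr
      _ = 1 := by rw [← Real.exp_add]; simp
  calc _ ≤ (1 / (l * n))^2 * (36 * (n:ℝ)^2) := by
        gcongr
        rw [integral_const_mul]; nlinarith
    _ = 147456 * σ^4 * D^2 := by rw [hl]; field_simp; norm_num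
    _ ≤ _ := by gcongr

/-- Lemma 4: tail and moment bounds for `(1/n)‖H(WᵀW)‖_op`. -/
theorem statement17 :
    ∃ c C C' : ℝ, 0 < c ∧ 0 < C ∧ 0 < C' ∧
      ∀ (n p : ℕ) (σ τ : ℝ), 1 ≤ n → 1 ≤ p → 0 < τ → τ ≤ σ →
        (∀ t : ℝ, C * σ ^ 2 * max 1 (Real.sqrt ((p : ℝ) / n)) ≤ t →
          ((lawW p n τ) {w | t ≤ opNorm (hollow (gramMat w)) / n}).toReal
            ≤ Real.exp (-(c * n * t / σ ^ 2) * min 1 (t * n / ((p : ℝ) * σ ^ 2)))) ∧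
        (∫ w, (opNorm (hollow (gramMat w)) / n) ^ 2 ∂(lawW p n τ))
          ≤ C' * σ ^ 4 * (1 + (p : ℝ) / n) := by
  refine ⟨1/256, 768, 147456, by norm_num, by norm_num, by norm_num, ?_⟩
  intro n p σ τ hn hp hτ hτσ
  exact ⟨fun t ht => aux_tail n p σ τ hn hp hτ hτσ t ht, aux_moment n p σ τ hn hp hτ hτσ⟩


end
end
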